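/- Let D be a model category and let d be an object of D. Let A_d be the category whose objects are acyclic cofibrations d → d' with d' fibrant, and whose morphisms (d → d') ⟶ (d → d'') are weak equivalences d' → d'' in D commuting with the given maps from d. Then the nerve N(A_d) is weakly contractible. -/

import Mathlib

open CategoryTheory CategoryTheory.Limits Simplicial

universe w v u

namespace Paper

/-- The map constant at vertex `i` of `Δ[1]`. -/
def constVertex (X : SSet.{w}) (i : Fin 2) : X ⟶ Δ[1] where
  app m := ↾fun _ => ULift.up (SimplexCategory.const m.unop ⦋1⦌ i)
  naturality _ _ _ := by ext _; rfl

/-- Elementary simplicial homotopy between two maps of simplicial sets,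
given by a map out of the cylinder `X ⨯ Δ[1]`. -/
def SHomotopy {X Y : SSet.{w}} (f g : X ⟶ Y) : Prop :=
  ∃ H : X ⨯ Δ[1] ⟶ Y,
    prod.lift (𝟙 X) (constVertex X 0) ≫ H = f ∧
    prod.lift (𝟙 X) (constVertex X 1) ≫ H = g

/-- The relation of being simplicially homotopic: the equivalence relation
generated by elementary simplicial homotopies. -/
def Htpy {X Y : SSet.{w}} (f g : X ⟶ Y) : Prop := Relation.EqvGen SHomotopy f g

/-- Kan complexes, as defined in the older Mathlib (`SSet.KanComplex`): all horns `Λ[n, i]`,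
including `n = 0`, have fillers. -/
class KanComplex (S : SSet.{w}) : Prop where
  hornFilling : ∀ ⦃n : ℕ⦄ ⦃i : Fin (n+1)⦄ (σ₀ : (Λ[n, i] : SSet.{w}) ⟶ S),
    ∃ σ : Δ[n] ⟶ S, σ₀ = Λ[n, i].ι ≫ σ

/-- A map of simplicial sets is a weak homotopy equivalence (in the Kan–Quillen sense)
iff for every Kan complex `K` the induced map on simplicial homotopy classes of maps
into `K` is a bijection. -/
def IsWeakHomotopyEquiv {X Y : SSet.{w}} (f : X ⟶ Y) : Prop :=
  ∀ (K : SSet.{w}), KanComplex K →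
    (∀ g : X ⟶ K, ∃ h : Y ⟶ K, Htpy (f ≫ h) g) ∧
    (∀ h h' : Y ⟶ K, Htpy (f ≫ h) (f ≫ h') → Htpy h h')

/-- A simplicial set is weakly contractible if its map to the terminal object
is a weak homotopy equivalence. -/
def WeaklyContractible (X : SSet.{w}) : Prop := IsWeakHomotopyEquiv (terminal.from X)

/-- The map on nerves induced by a functor. -/
def nerveMap {C : Type u} {D : Type u} [Category.{v} C] [Category.{v} D] (F : C ⥤ D) :
    nerve C ⟶ nerve D where
  app _ := ↾fun (G : ComposableArrows C _) => (G ⋙ F : ComposableArrows D _)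
  naturality _ _ _ := by ext _; rfl



/-- `f` is a retract of `g` in the arrow category. -/
def IsRetractOf {C : Type u} [Category.{v} C] {X Y X' Y' : C} (f : X ⟶ Y) (g : X' ⟶ Y') : Prop :=
  ∃ (i : X ⟶ X') (r : X' ⟶ X) (j : Y ⟶ Y') (s : Y' ⟶ Y),
    i ≫ r = 𝟙 X ∧ j ≫ s = 𝟙 Y ∧ i ≫ g = f ≫ j ∧ r ≫ f = g ≫ s

/-- A (Quillen) model structure on a category: three wide subcategories of weak
equivalences, cofibrations and fibrations, satisfying the two-out-of-three, retract,
lifting and factorization axioms.  (No functorial factorizations are assumed; a model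
category is a finitely bicomplete category equipped with such a structure.) -/
structure ModelStructure (C : Type u) [Category.{v} C] where
  W : MorphismProperty C
  Cof : MorphismProperty C
  Fib : MorphismProperty C
  W_id : ∀ X : C, W (𝟙 X)
  Cof_id : ∀ X : C, Cof (𝟙 X)
  Fib_id : ∀ X : C, Fib (𝟙 X)
  W_comp : ∀ {X Y Z : C} (f : X ⟶ Y) (g : Y ⟶ Z), W f → W g → W (f ≫ g)
  Cof_comp : ∀ {X Y Z : C} (f : X ⟶ Y) (g : Y ⟶ Z), Cof f → Cof g → Cof (f ≫ g)
  Fib_comp : ∀ {X Y Z : C} (f : X ⟶ Y) (g : Y ⟶ Z), Fib f → Fib g → Fib (f ≫ g)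
  W_of_precomp : ∀ {X Y Z : C} (f : X ⟶ Y) (g : Y ⟶ Z), W f → W (f ≫ g) → W g
  W_of_postcomp : ∀ {X Y Z : C} (f : X ⟶ Y) (g : Y ⟶ Z), W g → W (f ≫ g) → W f
  W_retract : ∀ {X Y X' Y' : C} {f : X ⟶ Y} {g : X' ⟶ Y'}, IsRetractOf f g → W g → W f
  Cof_retract : ∀ {X Y X' Y' : C} {f : X ⟶ Y} {g : X' ⟶ Y'}, IsRetractOf f g → Cof g → Cof f
  Fib_retract : ∀ {X Y X' Y' : C} {f : X ⟶ Y} {g : X' ⟶ Y'}, IsRetractOf f g → Fib g → Fib f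
  lifting_acof_fib : ∀ {A B X Y : C} (i : A ⟶ B) (p : X ⟶ Y),
    Cof i → W i → Fib p → HasLiftingProperty i p
  lifting_cof_afib : ∀ {A B X Y : C} (i : A ⟶ B) (p : X ⟶ Y),
    Cof i → Fib p → W p → HasLiftingProperty i p
  fact_acof_fib : ∀ {X Y : C} (f : X ⟶ Y),
    ∃ (Z : C) (i : X ⟶ Z) (p : Z ⟶ Y), Cof i ∧ W i ∧ Fib p ∧ i ≫ p = f
  fact_cof_afib : ∀ {X Y : C} (f : X ⟶ Y),
    ∃ (Z : C) (i : X ⟶ Z) (p : Z ⟶ Y), Cof i ∧ Fib p ∧ W p ∧ i ≫ p = f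

/-- An object is cofibrant if the map from an initial object is a cofibration. -/
def Cofibrant {C : Type u} [Category.{v} C] [HasInitial C] (M : ModelStructure C) (X : C) :
    Prop := M.Cof (initial.to X)

/-- An object is fibrant if the map to a terminal object is a fibration. -/
def Fibrant {C : Type u} [Category.{v} C] [HasTerminal C] (M : ModelStructure C) (X : C) :
    Prop := M.Fib (terminal.from X)

/-- A category with a wide subcategory of weak equivalences (a relative category
whose weak equivalences form a wide subcategory). -/
structure RelCatStruct (R : Type u) [Category.{v} R] where
  W : MorphismProperty R
  W_id : ∀ X : R, W (𝟙 X)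
  W_comp : ∀ {X Y Z : R} (f : X ⟶ Y) (g : Y ⟶ Z), W f → W g → W (f ≫ g)

/-- The underlying relative category of a model structure. -/
def ModelStructure.relcat {C : Type u} [Category.{v} C] (M : ModelStructure C) :
    RelCatStruct C :=
  ⟨M.W, M.W_id, M.W_comp⟩

/-- A Quillen adjunction between model categories: an adjunction `F ⊣ G` such that
`F` preserves cofibrations and acyclic cofibrations. -/
structure QuillenAdjunction {C : Type u} {D : Type u} [Category.{v} C] [Category.{v} D]
    (MC : ModelStructure C) (MD : ModelStructure D) where
  F : C ⥤ D
  G : D ⥤ C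
  adj : F ⊣ G
  F_cof : ∀ {X Y : C} (f : X ⟶ Y), MC.Cof f → MD.Cof (F.map f)
  F_acof : ∀ {X Y : C} (f : X ⟶ Y), MC.Cof f → MC.W f → MD.W (F.map f)


/-- The category of fibrant replacements of `d` by acyclic cofibrations: objects are
acyclic cofibrations `d → d'` with `d'` fibrant, morphisms are weak equivalences under
`d`. -/
structure FibRepl {D : Type u} [Category.{v} D] [HasTerminal D]
    (M : ModelStructure D) (d : D) where
  obj : D
  j : d ⟶ obj
  hW : M.W j
  hC : M.Cof j
  hfib : Fibrant M obj

instance {D : Type u} [Category.{v} D] [HasTerminal D] {M : ModelStructure D} {d : D} :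
    Category (FibRepl M d) where
  Hom A B := { v : A.obj ⟶ B.obj // M.W v ∧ A.j ≫ v = B.j }
  id A := ⟨𝟙 A.obj, M.W_id _, by simp⟩
  comp {A B C} φ ψ := ⟨φ.1 ≫ ψ.1, M.W_comp _ _ φ.2.1 ψ.2.1,
    by rw [← Category.assoc, φ.2.2, ψ.2.2]⟩
  id_comp _ := by apply Subtype.ext; simp
  comp_id _ := by apply Subtype.ext; simp
  assoc _ _ _ := by apply Subtype.ext; simp

section SimplicialSets

open MonoidalCategory CartesianMonoidalCategory

section Homotopies

/-- The inclusion of `X` in the cylinder `X ⊗ Δ[1]` at the vertex `i`. -/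
noncomputable def cylEnd (X : SSet.{w}) (i : Fin 2) : X ⟶ X ⊗ Δ[1] := lift (𝟙 X) (constVertex X i)

lemma shomotopy_iff {X Y : SSet.{w}} (f g : X ⟶ Y) :
    SHomotopy f g ↔ ∃ H : X ⊗ Δ[1] ⟶ Y, cylEnd X 0 ≫ H = f ∧ cylEnd X 1 ≫ H = g := by
  have h₁ (i : Fin 2) :
      prod.lift (𝟙 X) (constVertex X i) ≫ lift prod.fst prod.snd = cylEnd X i := by
    unfold cylEnd
    ext1
    · simpa using prod.lift_fst _ _
    · simpa using prod.lift_snd _ _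
  have h₂ (i : Fin 2) :
      cylEnd X i ≫ prod.lift (fst X Δ[1]) (snd X Δ[1]) = prod.lift (𝟙 X) (constVertex X i) := by
    unfold cylEnd; ext1 <;> simp
  constructor
  · rintro ⟨H, h0, h1⟩
    exact ⟨prod.lift (fst X Δ[1]) (snd X Δ[1]) ≫ H, by rw [← h0, ← h₂, Category.assoc],
      by rw [← h1, ← h₂, Category.assoc]⟩
  · rintro ⟨H, h0, h1⟩
    exact ⟨lift prod.fst prod.snd ≫ H, by rw [← h0, ← h₁, Category.assoc],
      by rw [← h1, ← h₁, Category.assoc]⟩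

lemma SHomotopy.postcomp {X Y Z : SSet.{w}} {f g : X ⟶ Y} (h : SHomotopy f g) (k : Y ⟶ Z) :
    SHomotopy (f ≫ k) (g ≫ k) := by
  obtain ⟨H, rfl, rfl⟩ := h
  exact ⟨H ≫ k, by simp, by simp⟩

lemma SHomotopy.precomp {X Y Z : SSet.{w}} {f g : X ⟶ Y} (h : SHomotopy f g) (k : Z ⟶ X) :
    SHomotopy (k ≫ f) (k ≫ g) := by
  rw [shomotopy_iff] at h ⊢
  obtain ⟨H, rfl, rfl⟩ := h
  exact ⟨(k ▷ _) ≫ H, rfl, rfl⟩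

lemma SHomotopy.refl {X Y : SSet.{w}} (f : X ⟶ Y) : SHomotopy f f := by
  rw [shomotopy_iff]
  exact ⟨fst _ _ ≫ f, rfl, rfl⟩

lemma Htpy.postcomp {X Y Z : SSet.{w}} {f g : X ⟶ Y} (h : Htpy f g) (k : Y ⟶ Z) :
    Htpy (f ≫ k) (g ≫ k) := by
  induction h with
  | rel _ _ h => exact .rel _ _ (h.postcomp k)
  | refl => exact .refl _
  | symm _ _ _ h => exact .symm _ _ h
  | trans _ _ _ _ _ h h' => exact .trans _ _ _ h h'

lemma Htpy.precomp {X Y Z : SSet.{w}} {f g : X ⟶ Y} (h : Htpy f g) (k : Z ⟶ X) :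
    Htpy (k ≫ f) (k ≫ g) := by
  induction h with
  | rel _ _ h => exact .rel _ _ (h.precomp k)
  | refl => exact .refl _
  | symm _ _ _ h => exact .symm _ _ h
  | trans _ _ _ _ _ h h' => exact .trans _ _ _ h h'

end Homotopies

section NaturalTransformations

variable {C D : Type u} [Category.{v} C] [Category.{v} D]

/-- The functor `C × Fin 2 ⥤ D` attached to a natural transformation. -/
def natTransFunctor {F G : C ⥤ D} (α : F ⟶ G) : C × Fin 2 ⥤ D :=
  CategoryTheory.Prod.swap C (Fin 2) ⋙ Functor.uncurry.obj (ComposableArrows.mk₁ α)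

/-- The cylinder homotopy attached to a natural transformation. -/
def nerveCyl {F G : C ⥤ D} (α : F ⟶ G) : nerve C ⊗ Δ[1] ⟶ nerve D where
  app m := ↾fun x =>
    (Functor.prod' (x.1 : Fin _ ⥤ C) (SSet.stdSimplex.asOrderHom x.2).monotone.functor ⋙
    natTransFunctor α : ComposableArrows D m.unop.len)
  naturality _ _ _ := by ext _; rfl

lemma natTransFunctor_map_const {F G : C ⥤ D} (α : F ⟶ G) {n : ℕ} (x : ComposableArrows C n)
    (i : Fin 2) (h : Monotone fun _ : Fin (n + 1) => i) {j k : Fin (n + 1)} (f : j ⟶ k) :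
    ((Functor.prod' (x : Fin _ ⥤ C) h.functor) ⋙ natTransFunctor α).map f =
      ((ComposableArrows.mk₁ α).obj i).map (x.map f) := by
  change ((ComposableArrows.mk₁ α).map (𝟙 _)).app _ ≫
    ((ComposableArrows.mk₁ α).obj i).map (x.map f) = _
  rw [CategoryTheory.Functor.map_id]
  exact Category.id_comp _

lemma cylEnd_zero_nerveCyl {F G : C ⥤ D} (α : F ⟶ G) :
    cylEnd _ 0 ≫ nerveCyl α = nerveMap F := by
  ext n x
  exact CategoryTheory.Functor.hext (fun _ => rfl)
    fun _ _ _ => heq_of_eq (natTransFunctor_map_const α x 0 _ _)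

lemma cylEnd_one_nerveCyl {F G : C ⥤ D} (α : F ⟶ G) :
    cylEnd _ 1 ≫ nerveCyl α = nerveMap G := by
  ext n x
  exact CategoryTheory.Functor.hext (fun _ => rfl)
    fun _ _ _ => heq_of_eq (natTransFunctor_map_const α x 1 _ _)

lemma SHomotopy.of_natTrans {F G : C ⥤ D} (α : F ⟶ G) : SHomotopy (nerveMap F) (nerveMap G) :=
  (shomotopy_iff _ _).2 ⟨nerveCyl α, cylEnd_zero_nerveCyl α, cylEnd_one_nerveCyl α⟩
end NaturalTransformations

section Kan
open HomotopicalAlgebra SSet.modelCategoryQuillen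

/-- Maps to a Kan complex extend along anodyne extensions. -/
lemma KanComplex.exists_extension {K : SSet.{w}} [hK : KanComplex K] {A B : SSet.{w}}
    {i : A ⟶ B} (hi : SSet.anodyneExtensions i) (f : A ⟶ K) : ∃ g : B ⟶ K, i ≫ g = f := by
  have hfib : Fibration (terminal.from K) := by
    rw [fibration_iff]
    intro X Y j hj
    simp only [J, MorphismProperty.iSup_iff] at hj
    obtain ⟨n, ⟨k⟩⟩ := hj
    refine ⟨fun {f g} sq => ?_⟩
    obtain ⟨σ, hσ⟩ := hK.hornFilling f
    exact ⟨⟨⟨σ, hσ.symm, Subsingleton.elim _ _⟩⟩⟩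
  have := hi (terminal.from K) ((HomotopicalAlgebra.fibration_iff _).1 hfib)
  have sq : CommSq f i (terminal.from K) (terminal.from B) := ⟨Subsingleton.elim _ _⟩
  exact ⟨sq.lift, sq.fac_left⟩

end Kan

lemma stdSimplex_one_eq_const {X : SSet.{w}} {m : SimplexCategoryᵒᵖ} (x : X.obj m)
   (u : (Δ[1] : SSet.{w}).obj m) (hu : u ∈ (∂Δ[1] : (Δ[1] : SSet.{w}).Subcomplex).obj m) :
    ∃ i, u = (constVertex X i).app m x := by
  change ¬ Function.Surjective _ at hu
  simp only [Function.Surjective, not_forall, not_exists] at hu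
  obtain ⟨i, hi⟩ := hu
  refine ⟨i.rev, ?_⟩
  apply SSet.stdSimplex.objEquiv.injective
  ext j : 3
  change SSet.stdSimplex.asOrderHom u j = i.rev
  have := hi j
  generalize SSet.stdSimplex.asOrderHom u j = a at this
  clear hi
  revert i a
  decide

lemma constVertex_ne {X : SSet.{w}} {m : SimplexCategoryᵒᵖ} (x : X.obj m) :
    (constVertex X 0).app m x ≠ (constVertex X 1).app m x := by
  intro h
  have : (0 : Fin 2) = 1 :=
    congrArg (fun u : (Δ[1] : SSet.{w}).obj m => SSet.stdSimplex.asOrderHom u 0) h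
  simp at this

lemma constVertex_mem_boundary {X : SSet.{w}} (i : Fin 2) {m : SimplexCategoryᵒᵖ} (x : X.obj m) :
    (constVertex X i).app m x ∈ (∂Δ[1] : (Δ[1] : SSet.{w}).Subcomplex).obj m := by
  intro h
  obtain ⟨j, hj⟩ := h i.rev
  change i = i.rev at hj
  clear h
  revert i
  decide

open Classical in
/-- A map on `U.unionProd ∂Δ[1]` given on both ends and on `U ⊗ Δ[1]`. -/
lemma exists_glue_cyl {X Y : SSet.{w}} (U : X.Subcomplex) (f g : X ⟶ Y)
    (h : (U : SSet.{w}) ⊗ Δ[1] ⟶ Y) (h0 : cylEnd _ 0 ≫ h = U.ι ≫ f)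
    (h1 : cylEnd _ 1 ≫ h = U.ι ≫ g) :
    ∃ k : (U.unionProd ∂Δ[1] : SSet.{w}) ⟶ Y, ∀ H : X ⊗ Δ[1] ⟶ Y,
      (U.unionProd ∂Δ[1]).ι ≫ H = k → cylEnd _ 0 ≫ H = f ∧ cylEnd _ 1 ≫ H = g := by
  have e0 {n} (x : (U : SSet.{w}).obj n) : h.app n (x, (constVertex X 0).app n x.1) = f.app n x.1 :=
    ConcreteCategory.congr_hom (NatTrans.congr_app h0 n) x
  have e1 {n} (x : (U : SSet.{w}).obj n) : h.app n (x, (constVertex X 1).app n x.1) = g.app n x.1 :=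
    ConcreteCategory.congr_hom (NatTrans.congr_app h1 n) x
  have hU {n : SimplexCategoryᵒᵖ} (z : (U.unionProd ∂Δ[1] : SSet.{w}).obj n)
      (z0 : z.1.2 ≠ (constVertex X 0).app n z.1.1) (z1 : z.1.2 ≠ (constVertex X 1).app n z.1.1) :
      z.1.1 ∈ U.obj n := by
    obtain h | h := (SSet.Subcomplex.mem_unionProd_iff ..).1 z.2
    · obtain ⟨i, hi⟩ := stdSimplex_one_eq_const z.1.1 _ h
      fin_cases i
      · exact (z0 hi).elim
      · exact (z1 hi).elim
    · exact h
  let F (n : SimplexCategoryᵒᵖ) (z : (U.unionProd ∂Δ[1] : SSet.{w}).obj n) : Y.obj n :=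
    if z0 : z.1.2 = (constVertex X 0).app n z.1.1 then f.app n z.1.1 else
    if z1 : z.1.2 = (constVertex X 1).app n z.1.1 then g.app n z.1.1 else
    h.app n (⟨z.1.1, hU z z0 z1⟩, z.1.2)
  have F0 {n} (z) (hz : z.1.2 = (constVertex X 0).app n z.1.1) : F n z = f.app n z.1.1 := dif_pos hz
  have F1 {n} (z) (hz : z.1.2 = (constVertex X 1).app n z.1.1) : F n z = g.app n z.1.1 := by
    have : ¬ z.1.2 = (constVertex X 0).app n z.1.1 := fun h => constVertex_ne _ (h.symm.trans hz)
    exact (dif_neg this).trans (dif_pos hz)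
  have F2 {n} (z) (hz : z.1.1 ∈ U.obj n) : F n z = h.app n (⟨z.1.1, hz⟩, z.1.2) := by
    by_cases z0 : z.1.2 = (constVertex X 0).app n z.1.1
    · rw [F0 z z0, z0]; exact (e0 ⟨z.1.1, hz⟩).symm
    · by_cases z1 : z.1.2 = (constVertex X 1).app n z.1.1
      · rw [F1 z z1, z1]; exact (e1 ⟨z.1.1, hz⟩).symm
      · exact (dif_neg z0).trans (dif_neg z1)
  have hc (i : Fin 2) {n : SimplexCategoryᵒᵖ} (x : X.obj n) :
      (x, (constVertex X i).app n x) ∈ (U.unionProd ∂Δ[1]).obj n :=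
    (SSet.Subcomplex.mem_unionProd_iff ..).2 (.inl (constVertex_mem_boundary i x))
  refine ⟨{ app n := ↾(F n), naturality m n θ := ?_ }, fun H hH => ⟨?_, ?_⟩⟩
  · ext z
    change F n _ = Y.map θ (F m z)
    have hc (i) (hi : z.1.2 = (constVertex X i).app m z.1.1) :
        Δ[1].map θ z.1.2 = (constVertex X i).app n (X.map θ z.1.1) := by
      rw [hi]; rfl
    by_cases z0 : z.1.2 = (constVertex X 0).app m z.1.1
    · rw [F0 z z0, ← NatTrans.naturality_apply]
      exact F0 _ (hc 0 z0)
    · by_cases z1 : z.1.2 = (constVertex X 1).app m z.1.1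
      · rw [F1 z z1, ← NatTrans.naturality_apply]
        exact F1 _ (hc 1 z1)
      · rw [F2 z (hU z z0 z1)]
        exact (F2 ((U.unionProd ∂Δ[1] : SSet.{w}).map θ z) (U.map θ (hU z z0 z1))).trans
          (NatTrans.naturality_apply h θ ((⟨z.1.1, hU z z0 z1⟩, z.1.2) :
            ((U : SSet.{w}) ⊗ Δ[1]).obj m))
  · ext n x
    exact (ConcreteCategory.congr_hom (NatTrans.congr_app hH n)
      ⟨(x, (constVertex X 0).app n x), hc 0 x⟩).trans (F0 _ rfl)
  · ext n x
    exact (ConcreteCategory.congr_hom (NatTrans.congr_app hH n)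
      ⟨(x, (constVertex X 1).app n x), hc 1 x⟩).trans (F1 _ rfl)
lemma htpy_of_anodyne {X K : SSet.{w}} [KanComplex K] (U : X.Subcomplex)
    (hU : SSet.anodyneExtensions U.ι) (f g : X ⟶ K) (h : Htpy (U.ι ≫ f) (U.ι ≫ g)) :
    Htpy f g := by
  obtain ⟨f', hf⟩ : ∃ f', f' = U.ι ≫ f := ⟨_, rfl⟩
  obtain ⟨g', hg⟩ : ∃ g', g' = U.ι ≫ g := ⟨_, rfl⟩
  rw [← hf, ← hg] at h
  have key (f g : X ⟶ K) (h : SHomotopy (U.ι ≫ f) (U.ι ≫ g)) : Htpy f g := by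
    rw [shomotopy_iff] at h
    obtain ⟨H, h0, h1⟩ := h
    obtain ⟨k, hk⟩ := exists_glue_cyl U f g H h0 h1
    obtain ⟨H', hH'⟩ := KanComplex.exists_extension
      (SSet.anodyneExtensions_unionProd_ι' U ∂Δ[1] hU) k
    exact .rel _ _ ((shomotopy_iff _ _).2 ⟨H', hk H' hH'⟩)
  induction h generalizing f g with
  | rel _ _ h => subst hf hg; exact key f g h
  | refl => exact key f g (by rw [← hf, ← hg]; exact .refl _)
  | symm _ _ _ h => exact .symm _ _ (h g f hg hf)
  | trans _ y _ _ _ h h' =>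
    obtain ⟨y', hy'⟩ := KanComplex.exists_extension hU y
    exact .trans _ _ _ (h f y' hf hy'.symm) (h' y' g hy'.symm hg)

section Deformation

variable {C : Type u} [Category.{v} C]

/-- The subcomplex of the nerve consisting of the chains of objects satisfying `P`. -/
def nerveFull (P : C → Prop) : (nerve C).Subcomplex where
  obj n := {x | ∀ i, P ((x : ComposableArrows C n.unop.len).obj i)}
  map _ _ hx _ := hx _

/-- If `c` maps everything into `P` and there is a natural transformation `c ⟶ 𝟭 C`, then
the inclusion of the chains in `P` is anodyne. -/
lemma anodyneExtensions_nerveFull_ι (P : C → Prop) (c : C ⥤ C) (hc : ∀ x, P (c.obj x))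
    (η : c ⟶ 𝟭 C) : SSet.anodyneExtensions (nerveFull P).ι := by
  set U := nerveFull P
  have hr (n) (z : (nerve C ⊗ Δ[1]).obj n) (hz : z ∈ (U.unionProd Λ[1, 0]).obj n) :
      (nerveCyl η).app n z ∈ U.obj n := by
    intro i
    change P ((((ComposableArrows.mk₁ η).obj (SSet.stdSimplex.asOrderHom z.2 i))).obj
      ((z.1 : ComposableArrows C n.unop.len).obj i))
    obtain h | h := (SSet.Subcomplex.mem_unionProd_iff ..).1 hz
    · have hi : SSet.stdSimplex.asOrderHom z.2 i = 0 := by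
        by_contra hi
        refine h (Set.eq_univ_of_forall fun j => ?_)
        by_cases hj : j = 0
        · exact .inr hj
        · exact .inl ⟨i, by grind⟩
      rw [hi]
      exact hc _
    · generalize SSet.stdSimplex.asOrderHom z.2 i = j
      fin_cases j
      · exact hc _
      · exact h i
  intro X Y p hp
  refine ⟨fun {f g} sq => ?_⟩
  let r : (U.unionProd Λ[1, 0] : SSet) ⟶ U :=
    SSet.Subcomplex.lift ((U.unionProd Λ[1, 0]).ι ≫ nerveCyl η) (by
      rintro n _ ⟨z, rfl⟩
      exact hr n z.1 z.2)
  have := SSet.anodyneExtensions_unionProd_ι U Λ[1, 0] (SSet.anodyneExtensions.horn_ι 0) p hp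
  have sq' : CommSq (r ≫ f) (U.unionProd Λ[1, 0]).ι p (nerveCyl η ≫ g) :=
    ⟨by rw [Category.assoc, sq.w]; rfl⟩
  let s : (U : SSet) ⟶ (U.unionProd Λ[1, 0] : SSet) :=
    SSet.Subcomplex.lift (U.ι ≫ cylEnd _ 1) (by
      rintro n _ ⟨z, rfl⟩
      exact (SSet.Subcomplex.mem_unionProd_iff ..).2 (.inr z.2))
  have h1 : cylEnd _ 1 ≫ nerveCyl η = 𝟙 _ := cylEnd_one_nerveCyl η
  have hsr : s ≫ r = 𝟙 _ := by
    rw [← cancel_mono U.ι]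
    change U.ι ≫ cylEnd _ 1 ≫ nerveCyl η = _
    rw [h1]
    rfl
  refine ⟨⟨⟨cylEnd _ 1 ≫ sq'.lift, ?_, ?_⟩⟩⟩
  · change s ≫ (U.unionProd Λ[1, 0]).ι ≫ sq'.lift = f
    rw [sq'.fac_left, reassoc_of% hsr]
  · rw [Category.assoc, sq'.fac_right, reassoc_of% h1]

end Deformation

section LocalToGlobal

variable {V S X Y : SSet.{w}} (ρ : V ⟶ S) {U : V.Subcomplex} (p : X ⟶ Y)
  (a : (U : SSet.{w}) ⟶ X) (b : V ⟶ Y)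

/-- A lift, over the simplex `σ` of `S`, in the square with sides `a`, `U.ι`, `p` and `b`. -/
structure PartialLift (n : SimplexCategoryᵒᵖ) where
  σ : S.obj n
  l (m : SimplexCategoryᵒᵖ) (θ : n ⟶ m) (z : V.obj m) (hz : ρ.app m z = S.map θ σ) : X.obj m
  map_l {m m' : SimplexCategoryᵒᵖ} (θ : n ⟶ m) (β : m ⟶ m') (z : V.obj m)
    (hz : ρ.app m z = S.map θ σ) (hz' : ρ.app m' (V.map β z) = S.map (θ ≫ β) σ) :
    X.map β (l m θ z hz) = l m' (θ ≫ β) (V.map β z) hz'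
  l_eq {m : SimplexCategoryᵒᵖ} (θ : n ⟶ m) (z : V.obj m) (hz : ρ.app m z = S.map θ σ)
    (hU : z ∈ U.obj m) : l m θ z hz = a.app m ⟨z, hU⟩
  app_l {m : SimplexCategoryᵒᵖ} (θ : n ⟶ m) (z : V.obj m) (hz : ρ.app m z = S.map θ σ) :
    p.app m (l m θ z hz) = b.app m z

namespace PartialLift

variable {ρ p a b}

lemma ext_of {n : SimplexCategoryᵒᵖ} {e e' : PartialLift ρ p a b n} (hσ : e.σ = e'.σ)
    (hl : ∀ m θ z hz hz', e.l m θ z hz = e'.l m θ z hz') : e = e' := by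
  cases e
  cases e'
  dsimp at hσ
  subst hσ
  congr
  funext m θ z hz
  exact hl m θ z hz hz

lemma l_congr {n : SimplexCategoryᵒᵖ} {e e' : PartialLift ρ p a b n} (h : e = e')
    {m : SimplexCategoryᵒᵖ} {θ θ' : n ⟶ m} (hθ : θ = θ') {z z' : V.obj m} (h' : z = z')
    (hz : ρ.app m z = S.map θ e.σ) (hz' : ρ.app m z' = S.map θ' e'.σ) :
    e.l m θ z hz = e'.l m θ' z' hz' := by
  subst h hθ h'
  rfl

variable (ρ p a b)

variable {ρ p a b} in
/-- The restriction of a partial lift. -/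
def restrict {n n' : SimplexCategoryᵒᵖ} (β : n ⟶ n') (e : PartialLift ρ p a b n) :
    PartialLift ρ p a b n' where
  σ := S.map β e.σ
  l m θ z hz := e.l m (β ≫ θ) z (by rw [hz, Functor.map_comp_apply])
  map_l θ γ z hz hz' := by
    rw [e.map_l _ _ _ _ (by rw [hz', ← Functor.map_comp_apply, Category.assoc])]
    exact l_congr rfl (Category.assoc ..) rfl _ _
  l_eq θ z hz hU := e.l_eq _ _ _ hU
  app_l θ z hz := e.app_l _ _ _

lemma restrict_id {n : SimplexCategoryᵒᵖ} (e : PartialLift ρ p a b n) : restrict (𝟙 n) e = e :=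
  ext_of (by simp [restrict]) fun m θ z hz hz' => l_congr rfl (Category.id_comp _) rfl _ _

lemma restrict_comp {n n' n'' : SimplexCategoryᵒᵖ} (β : n ⟶ n') (γ : n' ⟶ n'')
    (e : PartialLift ρ p a b n) : restrict (β ≫ γ) e = restrict γ (restrict β e) :=
  ext_of (by simp [restrict]) fun m θ z hz hz' => l_congr rfl (Category.assoc ..) rfl _ _

/-- The simplicial set of partial lifts. -/
def sset : SSet.{w} where
  obj n := PartialLift ρ p a b n
  map β := ↾restrict β
  map_id _ := by
    ext e
    exact restrict_id _ _ _ _ e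
  map_comp β γ := by
    ext e
    exact restrict_comp _ _ _ _ β γ e

/-- The projection from the simplicial set of partial lifts to the base. -/
def π : sset ρ p a b ⟶ S where
  app n := ↾fun e => PartialLift.σ e
  naturality _ _ _ := by ext _; rfl

variable {ρ p a b}

end PartialLift

variable {ρ p a b}

/-- A compatible family of lifts over the simplices of `B`. -/
structure LiftData (p : X ⟶ Y) (a : (U : SSet.{w}) ⟶ X) (b : V ⟶ Y) {B : SSet.{w}} (ρ : V ⟶ S)
    (τ : B ⟶ S) where
  T (m : SimplexCategoryᵒᵖ) (y : B.obj m) (z : V.obj m) (hz : ρ.app m z = τ.app m y) : X.obj m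
  map_T {m m' : SimplexCategoryᵒᵖ} (β : m ⟶ m') (y : B.obj m) (z : V.obj m)
    (hz : ρ.app m z = τ.app m y) (hz' : ρ.app m' (V.map β z) = τ.app m' (B.map β y)) :
    X.map β (T m y z hz) = T m' (B.map β y) (V.map β z) hz'
  T_eq {m : SimplexCategoryᵒᵖ} (y : B.obj m) (z : V.obj m) (hz : ρ.app m z = τ.app m y)
    (hU : z ∈ U.obj m) : T m y z hz = a.app m ⟨z, hU⟩
  app_T {m : SimplexCategoryᵒᵖ} (y : B.obj m) (z : V.obj m) (hz : ρ.app m z = τ.app m y) :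
    p.app m (T m y z hz) = b.app m z

namespace LiftData

variable {B : SSet.{w}} {τ : B ⟶ S}

/-- The map to the simplicial set of partial lifts attached to a compatible family of lifts. -/
def hom (D : LiftData p a b ρ τ) : B ⟶ PartialLift.sset ρ p a b where
  app n := ↾fun y =>
    { σ := τ.app n y
      l m θ z hz := D.T m (B.map θ y) z (by rw [hz, NatTrans.naturality_apply])
      map_l θ β z hz hz' := by
        rw [D.map_T β _ z _ (by rw [hz', ← Functor.map_comp_apply, ← NatTrans.naturality_apply])]
        congr 1
        rw [Functor.map_comp_apply]
      l_eq θ z hz hU := D.T_eq _ _ _ hU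
      app_l θ z hz := D.app_T _ _ _ }
  naturality n n' β := by
    ext y
    refine PartialLift.ext_of (NatTrans.naturality_apply ..) fun m θ z hz hz' => ?_
    change D.T _ _ _ _ = D.T _ _ _ _
    congr 1
    exact (Functor.map_comp_apply ..).symm

lemma exists_of_hom (β : B ⟶ PartialLift.sset ρ p a b) (h : β ≫ PartialLift.π ρ p a b = τ) :
    ∃ D : LiftData p a b ρ τ, D.hom = β := by
  subst h
  let e (m : SimplexCategoryᵒᵖ) (y : B.obj m) : PartialLift ρ p a b m := β.app m y
  have he {m m' : SimplexCategoryᵒᵖ} (θ : m ⟶ m') (y : B.obj m) :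
      e m' (B.map θ y) = PartialLift.restrict θ (e m y) := NatTrans.naturality_apply β θ y
  have key {m m' : SimplexCategoryᵒᵖ} (θ : m ⟶ m') (y : B.obj m) (z : V.obj m')
      (hz : ρ.app m' z = S.map (𝟙 m') (e m' (B.map θ y)).σ)
      (hz' : ρ.app m' z = S.map θ (e m y).σ) :
      (e m' (B.map θ y)).l m' (𝟙 m') z hz = (e m y).l m' θ z hz' := by
    rw [PartialLift.l_congr (he θ y) rfl rfl hz (by simp [hz', PartialLift.restrict])]
    exact PartialLift.l_congr (e := e m y) rfl (Category.comp_id _) rfl _ _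
  have he₁ {m : SimplexCategoryᵒᵖ} (y : B.obj m) (z : V.obj m)
      (hz : ρ.app m z = (e m y).σ) : ρ.app m z = S.map (𝟙 m) (e m y).σ := by simp [hz]
  refine ⟨⟨fun m y z hz => (e m y).l m (𝟙 m) z (he₁ y z hz),
    fun θ y z hz hz' => ?_, fun y z hz hU => (e _ y).l_eq _ _ _ _,
    fun y z hz => (e _ y).app_l _ _ _⟩, ?_⟩
  · rw [PartialLift.map_l (hz' := by
      rw [Category.id_comp, NatTrans.naturality_apply, hz]; rfl), key]
    · exact PartialLift.l_congr (e := e _ y) rfl (Category.id_comp _) rfl _ _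
    · rw [NatTrans.naturality_apply, hz]
      rfl
  · ext m y
    exact PartialLift.ext_of rfl fun m θ z hz hz' => key ..

end LiftData

end LocalToGlobal

section LocalToGlobal

/-- A parametrization of the part of `V` over the simplex `σ` of `S` by a product `Φ ⊗ Δ[n]`, which
is bijective away from the boundary of `σ`. -/
structure LocalCover {V S : SSet.{w}} (ρ : V ⟶ S) (U : V.Subcomplex) {n : ℕ} (σ : Δ[n] ⟶ S) where
  Φ : SSet.{w}
  sub : Φ.Subcomplex
  anodyne : SSet.anodyneExtensions sub.ι
  Ψ : Φ ⊗ Δ[n] ⟶ V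
  app_Ψ {m : SimplexCategoryᵒᵖ} (z : (Φ ⊗ Δ[n]).obj m) : ρ.app m (Ψ.app m z) = σ.app m z.2
  bijective {m : SimplexCategoryᵒᵖ} (θ : (Δ[n] : SSet.{w}).obj m)
    (hθ : θ ∉ (∂Δ[n] : (Δ[n] : SSet.{w}).Subcomplex).obj m) (z : V.obj m)
    (hz : ρ.app m z = σ.app m θ) : ∃! y : Φ.obj m, Ψ.app m (y, θ) = z
  mem {m : SimplexCategoryᵒᵖ} (z : (Φ ⊗ Δ[n]).obj m) (hz : z.1 ∈ sub.obj m) : Ψ.app m z ∈ U.obj m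
  of_mem {m : SimplexCategoryᵒᵖ} (z : (Φ ⊗ Δ[n]).obj m)
    (hz : z.2 ∉ (∂Δ[n] : (Δ[n] : SSet.{w}).Subcomplex).obj m) (h : Ψ.app m z ∈ U.obj m) :
    z.1 ∈ sub.obj m

variable {V S X Y : SSet.{w}} {ρ : V ⟶ S} {U : V.Subcomplex} {p : X ⟶ Y}
  {a : (U : SSet.{w}) ⟶ X} {b : V ⟶ Y}

open HomotopicalAlgebra SSet.modelCategoryQuillen

lemma PartialLift.exists_lift_of_section
    (s : ∀ m : SimplexCategoryᵒᵖ, S.obj m → PartialLift ρ p a b m)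
    (hs : ∀ (m : SimplexCategoryᵒᵖ) (x : S.obj m), (s m x).σ = x)
    (hs' : ∀ {m m' : SimplexCategoryᵒᵖ} (θ : m ⟶ m') (x : S.obj m),
      s m' (S.map θ x) = PartialLift.restrict θ (s m x)) :
    ∃ f : V ⟶ X, U.ι ≫ f = a ∧ f ≫ p = b := by
  have hz {m : SimplexCategoryᵒᵖ} (z : V.obj m) :
      ρ.app m z = S.map (𝟙 m) (s m (ρ.app m z)).σ := by simp [hs]
  refine ⟨{ app m := ↾fun z => (s m (ρ.app m z)).l m (𝟙 m) z (hz z), naturality m m' θ := ?_ },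
    ?_, ?_⟩
  · ext z
    change (s m' (ρ.app m' (V.map θ z))).l m' (𝟙 m') (V.map θ z) (hz _) =
      X.map θ ((s m (ρ.app m z)).l m (𝟙 m) z (hz z))
    rw [PartialLift.map_l (hz' := by simp [hs, NatTrans.naturality_apply])]
    have h : s m' (ρ.app m' (V.map θ z)) = restrict θ (s m (ρ.app m z)) := by
      rw [NatTrans.naturality_apply, hs']
    rw [PartialLift.l_congr (e' := restrict θ (s m (ρ.app m z))) h rfl rfl _
      (by simp [hs, restrict, NatTrans.naturality_apply])]
    exact PartialLift.l_congr (e := s m (ρ.app m z)) rfl (by simp) rfl _ _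
  · ext m z
    exact PartialLift.l_eq _ _ _ _ _
  · ext m z
    exact PartialLift.app_l _ _ _ _

open Classical in
lemma LocalCover.exists_lift {n : ℕ} {σ : Δ[n] ⟶ S} (c : LocalCover ρ U σ)
    (hp : fibrations _ p) (h : a ≫ p = U.ι ≫ b) (D : LiftData p a b ρ (∂Δ[n].ι ≫ σ)) :
    ∃ L : c.Φ ⊗ Δ[n] ⟶ X, L ≫ p = c.Ψ ≫ b ∧
      (∀ (m : SimplexCategoryᵒᵖ) (z : (c.Φ ⊗ Δ[n]).obj m)
        (hz : z.2 ∈ (∂Δ[n] : (Δ[n] : SSet.{w}).Subcomplex).obj m),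
        L.app m z = D.T m ⟨z.2, hz⟩ (c.Ψ.app m z) (c.app_Ψ z)) ∧
      (∀ (m : SimplexCategoryᵒᵖ) (z : (c.Φ ⊗ Δ[n]).obj m) (hz : z.1 ∈ c.sub.obj m),
        L.app m z = a.app m ⟨c.Ψ.app m z, c.mem z hz⟩) := by
  let R := c.sub.unionProd (∂Δ[n] : (Δ[n] : SSet.{w}).Subcomplex)
  have hR {m : SimplexCategoryᵒᵖ} (z : (c.Φ ⊗ Δ[n]).obj m) (hz : z ∈ R.obj m)
      (h : z.2 ∉ (∂Δ[n] : (Δ[n] : SSet.{w}).Subcomplex).obj m) : z.1 ∈ c.sub.obj m :=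
    ((SSet.Subcomplex.mem_unionProd_iff ..).1 hz).resolve_left h
  let F (m : SimplexCategoryᵒᵖ) (z : (c.Φ ⊗ Δ[n]).obj m) (hz : z ∈ R.obj m) : X.obj m :=
    if hθ : z.2 ∈ (∂Δ[n] : (Δ[n] : SSet.{w}).Subcomplex).obj m then
      D.T m ⟨z.2, hθ⟩ (c.Ψ.app m z) (c.app_Ψ z)
    else a.app m ⟨c.Ψ.app m z, c.mem z (hR z hz hθ)⟩
  have F₁ {m} (z) (hz) (hθ : z.2 ∈ (∂Δ[n] : (Δ[n] : SSet.{w}).Subcomplex).obj m) :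
      F m z hz = D.T m ⟨z.2, hθ⟩ (c.Ψ.app m z) (c.app_Ψ z) := dif_pos hθ
  have F₂ {m} (z) (hz) (hy : z.1 ∈ c.sub.obj m) :
      F m z hz = a.app m ⟨c.Ψ.app m z, c.mem z hy⟩ := by
    by_cases hθ : z.2 ∈ (∂Δ[n] : (Δ[n] : SSet.{w}).Subcomplex).obj m
    · rw [F₁ z hz hθ]
      exact D.T_eq _ _ _ _
    · exact dif_neg hθ
  let f : (R : SSet.{w}) ⟶ X :=
    { app m := ↾fun z => F m z.1 z.2
      naturality m m' γ := by
        ext z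
        obtain ⟨z, hz⟩ := z
        change F m' ((c.Φ ⊗ Δ[n]).map γ z) (R.map γ hz) = X.map γ (F m z hz)
        by_cases hθ : z.2 ∈ (∂Δ[n] : (Δ[n] : SSet.{w}).Subcomplex).obj m
        · rw [F₁ z hz hθ, F₁ ((c.Φ ⊗ Δ[n]).map γ z) (R.map γ hz)
            ((∂Δ[n] : (Δ[n] : SSet.{w}).Subcomplex).map γ hθ)]
          have e : c.Ψ.app m' ((c.Φ ⊗ Δ[n]).map γ z) = V.map γ (c.Ψ.app m z) :=
            NatTrans.naturality_apply c.Ψ γ z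
          refine Eq.trans ?_ (D.map_T γ ⟨z.2, hθ⟩ (c.Ψ.app m z) (c.app_Ψ z)
            ((congr_arg (ρ.app m') e).symm.trans (c.app_Ψ ((c.Φ ⊗ Δ[n]).map γ z)))).symm
          congr 1
        · rw [F₂ z hz (hR z hz hθ), F₂ ((c.Φ ⊗ Δ[n]).map γ z) (R.map γ hz)
            (c.sub.map γ (hR z hz hθ))]
          refine Eq.trans ?_ (NatTrans.naturality_apply a γ _)
          congr 1
          exact Subtype.ext (NatTrans.naturality_apply c.Ψ γ z) }
  have sq : CommSq f R.ι p (c.Ψ ≫ b) := ⟨by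
    ext m ⟨z, hz⟩
    change p.app m (F m z hz) = b.app m (c.Ψ.app m z)
    by_cases hθ : z.2 ∈ (∂Δ[n] : (Δ[n] : SSet.{w}).Subcomplex).obj m
    · rw [F₁ z hz hθ]
      exact D.app_T _ _ _
    · rw [F₂ z hz (hR z hz hθ)]
      exact ConcreteCategory.congr_hom (NatTrans.congr_app h m) _⟩
  have := SSet.anodyneExtensions_unionProd_ι' c.sub ∂Δ[n] c.anodyne p hp
  have hL {m : SimplexCategoryᵒᵖ} (z : (c.Φ ⊗ Δ[n]).obj m) (hz : z ∈ R.obj m) :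
      sq.lift.app m z = F m z hz :=
    ConcreteCategory.congr_hom (NatTrans.congr_app sq.fac_left m) (⟨z, hz⟩ : (R : SSet.{w}).obj m)
  refine ⟨sq.lift, sq.fac_right, fun m z hz => ?_, fun m z hz => ?_⟩
  · have h' : z ∈ R.obj m := (SSet.Subcomplex.mem_unionProd_iff ..).2 (.inl hz)
    exact (hL z h').trans (F₁ z h' hz)
  · have h' : z ∈ R.obj m := (SSet.Subcomplex.mem_unionProd_iff ..).2 (.inr hz)
    exact (hL z h').trans (F₂ z h' hz)

open Classical in
lemma LocalCover.exists_liftData {n : ℕ} {σ : Δ[n] ⟶ S} (c : LocalCover ρ U σ)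
    (hp : fibrations _ p) (h : a ≫ p = U.ι ≫ b) (D : LiftData p a b ρ (∂Δ[n].ι ≫ σ)) :
    ∃ D' : LiftData p a b ρ σ, ∂Δ[n].ι ≫ D'.hom = D.hom := by
  obtain ⟨L, hLp, hL₁, hL₂⟩ := c.exists_lift hp h D
  choose y hy hy' using fun (m : SimplexCategoryᵒᵖ) (θ : (Δ[n] : SSet.{w}).obj m) (z : V.obj m)
    (hθ : θ ∉ (∂Δ[n] : (Δ[n] : SSet.{w}).Subcomplex).obj m) (hz : ρ.app m z = σ.app m θ) =>
      c.bijective θ hθ z hz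
  let T (m : SimplexCategoryᵒᵖ) (θ : (Δ[n] : SSet.{w}).obj m) (z : V.obj m)
      (hz : ρ.app m z = σ.app m θ) : X.obj m :=
    if hθ : θ ∈ (∂Δ[n] : (Δ[n] : SSet.{w}).Subcomplex).obj m then D.T m ⟨θ, hθ⟩ z hz
    else L.app m ((y m θ z hθ hz, θ) : (c.Φ ⊗ Δ[n]).obj m)
  have T₁ {m} (θ) (z) (hz) (hθ : θ ∈ (∂Δ[n] : (Δ[n] : SSet.{w}).Subcomplex).obj m) :
      T m θ z hz = D.T m ⟨θ, hθ⟩ z hz := dif_pos hθ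
  have T₂ {m} (θ) (z) (hz) (x : c.Φ.obj m)
      (hx : c.Ψ.app m ((x, θ) : (c.Φ ⊗ Δ[n]).obj m) = z) :
      T m θ z hz = L.app m ((x, θ) : (c.Φ ⊗ Δ[n]).obj m) := by
    subst hx
    by_cases hθ : θ ∈ (∂Δ[n] : (Δ[n] : SSet.{w}).Subcomplex).obj m
    · exact (T₁ _ _ hz hθ).trans (hL₁ m (x, θ) hθ).symm
    · refine (dif_neg hθ).trans ?_
      exact congr_arg (fun x => L.app m ((x, θ) : (c.Φ ⊗ Δ[n]).obj m)) (hy' m θ _ hθ hz x rfl).symm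
  let D' : LiftData p a b ρ σ :=
    { T := T
      map_T {m m'} β θ z hz hz' := by
        by_cases hθ : θ ∈ (∂Δ[n] : (Δ[n] : SSet.{w}).Subcomplex).obj m
        · rw [T₁ θ z hz hθ, T₁ ((Δ[n] : SSet.{w}).map β θ) (V.map β z) hz'
            ((∂Δ[n] : (Δ[n] : SSet.{w}).Subcomplex).map β hθ)]
          exact D.map_T β ⟨θ, hθ⟩ z hz hz'
        · rw [T₂ θ z hz _ (hy m θ z hθ hz), T₂ ((Δ[n] : SSet.{w}).map β θ) (V.map β z) hz'
            (c.Φ.map β (y m θ z hθ hz)) ?_]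
          · exact (NatTrans.naturality_apply L β _).symm
          · refine (NatTrans.naturality_apply c.Ψ β
              ((y m θ z hθ hz, θ) : (c.Φ ⊗ Δ[n]).obj m)).trans ?_
            rw [hy m θ z hθ hz]
      T_eq {m} θ z hz hU := by
        by_cases hθ : θ ∈ (∂Δ[n] : (Δ[n] : SSet.{w}).Subcomplex).obj m
        · rw [T₁ θ z hz hθ]
          exact D.T_eq _ _ _ _
        · rw [T₂ θ z hz _ (hy m θ z hθ hz)]
          refine (hL₂ m (y m θ z hθ hz, θ) (c.of_mem (y m θ z hθ hz, θ) hθ ?_)).trans ?_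
          · rwa [hy m θ z hθ hz]
          · congr 1
            exact Subtype.ext (hy m θ z hθ hz)
      app_T {m} θ z hz := by
        by_cases hθ : θ ∈ (∂Δ[n] : (Δ[n] : SSet.{w}).Subcomplex).obj m
        · rw [T₁ θ z hz hθ]
          exact D.app_T _ _ _
        · rw [T₂ θ z hz _ (hy m θ z hθ hz)]
          refine (ConcreteCategory.congr_hom (NatTrans.congr_app hLp m)
            ((y m θ z hθ hz, θ) : (c.Φ ⊗ Δ[n]).obj m)).trans ?_
          exact congr_arg (b.app m) (hy m θ z hθ hz) }
  refine ⟨D', ?_⟩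
  ext m θ
  refine PartialLift.ext_of rfl fun m' β z hz hz' => ?_
  exact T₁ _ _ _ ((∂Δ[n] : (Δ[n] : SSet.{w}).Subcomplex).map β θ.2)

/-- A map which locally over the base is anodyne, is anodyne. -/
theorem anodyneExtensions_of_localCover
    (H : ∀ (n : ℕ) (σ : Δ[n] ⟶ S), Nonempty (LocalCover ρ U σ)) :
    SSet.anodyneExtensions U.ι := by
  intro X Y p hp
  refine ⟨fun {a b} sq => ?_⟩
  have hI : I.rlp (PartialLift.π ρ p a b) := by
    rintro _ _ _ ⟨n⟩
    refine ⟨fun {f g} sq' => ?_⟩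
    obtain ⟨D, rfl⟩ := LiftData.exists_of_hom f sq'.w
    obtain ⟨D', h⟩ := (H n g).some.exists_liftData hp sq.w D
    exact ⟨⟨⟨D'.hom, h, rfl⟩⟩⟩
  rw [← SSet.rlp_monomorphisms] at hI
  have := hI (⊥ : S.Subcomplex).ι (MorphismProperty.monomorphisms.infer_property _)
  have sq' : CommSq (SSet.Subcomplex.isInitialBot.to _) (⊥ : S.Subcomplex).ι
    (PartialLift.π ρ p a b) (𝟙 S) := ⟨SSet.Subcomplex.isInitialBot.hom_ext _ _⟩
  let s (m : SimplexCategoryᵒᵖ) (x : S.obj m) : PartialLift ρ p a b m := sq'.lift.app m x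
  have hs (m : SimplexCategoryᵒᵖ) (x : S.obj m) : (s m x).σ = x := by
    have := ConcreteCategory.congr_hom (NatTrans.congr_app sq'.fac_right m) x
    exact this
  have hs' {m m' : SimplexCategoryᵒᵖ} (θ : m ⟶ m') (x : S.obj m) :
      s m' (S.map θ x) = PartialLift.restrict θ (s m x) :=
    NatTrans.naturality_apply sq'.lift θ x
  obtain ⟨f, h₁, h₂⟩ := PartialLift.exists_lift_of_section s hs hs'
  exact ⟨⟨⟨f, h₁, h₂⟩⟩⟩

end LocalToGlobal

end SimplicialSets

section OrderEmbeddings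

/-- The order embeddings of an `m`-element chain into an `n`-element chain. -/
inductive OrdEmb : ℕ → ℕ → Type v where
  /-- The order embedding between empty chains. -/
  | nil : OrdEmb 0 0
  /-- The extension of an order embedding which avoids the new element. -/
  | avoid {m n : ℕ} (f : OrdEmb m n) : OrdEmb m (n + 1)
  /-- The extension of an order embedding which maps the new element to the new element. -/
  | keep {m n : ℕ} (f : OrdEmb m n) : OrdEmb (m + 1) (n + 1)

namespace OrdEmb

/-- The identity order embedding. -/
protected def id (n : ℕ) : OrdEmb.{v} n n :=
  match n with
  | 0 => nil
  | n + 1 => keep (OrdEmb.id n)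

/-- The unique order embedding from the empty chain. -/
def empty (n : ℕ) : OrdEmb.{v} 0 n :=
  match n with
  | 0 => nil
  | n + 1 => avoid (empty n)

/-- The composition of order embeddings. -/
def comp {l m n : ℕ} (f : OrdEmb.{v} l m) (g : OrdEmb.{v} m n) : OrdEmb.{v} l n :=
  match l, m, n, f, g with
  | _, _, _, f, nil => f
  | _, _, _, f, avoid g => avoid (comp f g)
  | _, _, _, avoid f, keep g => avoid (comp f g)
  | _, _, _, keep f, keep g => keep (comp f g)

@[simp]
lemma comp_nil {l : ℕ} (f : OrdEmb.{v} l 0) : comp f nil = f := by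
  cases f
  rfl

@[simp]
lemma avoid_comp_keep {l m n : ℕ} (f : OrdEmb.{v} l m) (g : OrdEmb.{v} m n) :
    comp (avoid f) (keep g) = avoid (comp f g) := rfl

@[simp]
lemma comp_avoid {l m n : ℕ} (f : OrdEmb.{v} l m) (g : OrdEmb.{v} m n) :
    comp f (avoid g) = avoid (comp f g) := by
  cases f <;> rfl

@[simp]
lemma keep_comp_keep {l m n : ℕ} (f : OrdEmb.{v} l m) (g : OrdEmb.{v} m n) :
    comp (keep f) (keep g) = keep (comp f g) := rfl

@[simp]
lemma comp_id {m n : ℕ} (f : OrdEmb.{v} m n) : comp f (OrdEmb.id n) = f := by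
  induction f with
  | nil => rfl
  | avoid f ih => simp [OrdEmb.id, ih]
  | keep f ih => simp [OrdEmb.id, ih]

@[simp]
lemma id_comp {m n : ℕ} (f : OrdEmb.{v} m n) : comp (OrdEmb.id m) f = f := by
  induction f with
  | nil => rfl
  | avoid f ih => simp [ih]
  | keep f ih => simp [OrdEmb.id, ih]

lemma comp_assoc {k l m n : ℕ} (f : OrdEmb.{v} k l) (g : OrdEmb.{v} l m) (h : OrdEmb.{v} m n) :
    comp (comp f g) h = comp f (comp g h) := by
  induction h generalizing k l with
  | nil => simp
  | avoid h ih => simp [ih]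
  | keep h ih =>
    cases g with
    | avoid g => simp [ih]
    | keep g => cases f <;> simp [ih]

lemma le {m n : ℕ} (f : OrdEmb.{v} m n) : m ≤ n := by
  induction f <;> omega

instance (n : ℕ) : Subsingleton (OrdEmb.{v} 0 n) := ⟨fun f g => by
  induction n with
  | zero => cases f; cases g; rfl
  | succ n ih =>
    cases f with | avoid f => cases g with | avoid g => rw [ih f g]⟩

instance (n : ℕ) : Subsingleton (OrdEmb.{v} n n) := ⟨fun f g => by
  induction n with
  | zero => exact Subsingleton.elim f g
  | succ n ih =>
    cases f with
    | avoid f => exact absurd f.le (by simp)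
    | keep f =>
      cases g with
      | avoid g => exact absurd g.le (by simp)
      | keep g => rw [ih f g]⟩

instance (m n : ℕ) : Finite (OrdEmb.{v} m n) := by
  induction n generalizing m with
  | zero =>
    cases m with
    | zero => infer_instance
    | succ m =>
      have : IsEmpty (OrdEmb.{v} (m + 1) 0) := ⟨fun f => by cases f⟩
      infer_instance
  | succ n ih =>
    have := ih m
    cases m with
    | zero => infer_instance
    | succ m =>
      have := ih m
      refine Finite.of_surjective (α := OrdEmb.{v} (m + 1) n ⊕ OrdEmb.{v} m n)
        (Sum.elim avoid keep) fun f => ?_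
      cases f with
      | avoid f => exact ⟨.inl f, rfl⟩
      | keep f => exact ⟨.inr f, rfl⟩

end OrdEmb

set_option linter.checkUnivs false in
/-- The opposite of the category of finite chains and order embeddings. -/
structure ChainOp : Type (max u v) where
  len : ℕ

instance : Category.{v} ChainOp.{v, u} where
  Hom n m := OrdEmb.{v} m.len n.len
  id n := .id n.len
  comp f g := .comp g f
  id_comp := OrdEmb.comp_id
  comp_id := OrdEmb.id_comp
  assoc _ _ _ := (OrdEmb.comp_assoc _ _ _).symm

end OrderEmbeddings

section Fillers

variable {C : Type (max u v)} [Category.{v} C]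

/-- The map between the values of `E` given by an order embedding. -/
abbrev face (E : ChainOp.{v, u} ⥤ C) {m n : ℕ} (f : OrdEmb.{v} m n) : E.obj ⟨n⟩ ⟶ E.obj ⟨m⟩ :=
  E.map (X := ⟨n⟩) (Y := ⟨m⟩) f

lemma face_id (E : ChainOp.{v, u} ⥤ C) (n : ℕ) : face E (.id n) = 𝟙 _ := E.map_id _

lemma face_comp (E : ChainOp.{v, u} ⥤ C) {l m n : ℕ} (f : OrdEmb.{v} m n) (g : OrdEmb.{v} l m) :
    face E (g.comp f) = face E f ≫ face E g := E.map_comp (X := ⟨n⟩) (Y := ⟨m⟩) (Z := ⟨l⟩) f g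

/-- Compatible families of maps from `a` to the proper faces extend. -/
def HasFillers (E : ChainOp.{v, u} ⥤ C) (a : C) : Prop :=
  ∀ (n : ℕ) (ψ : ∀ m : ℕ, m ≤ n → OrdEmb.{v} m (n + 1) → (a ⟶ E.obj ⟨m⟩)),
    (∀ (m : ℕ) (hm : m ≤ n) (f : OrdEmb.{v} m (n + 1)) (l : ℕ) (g : OrdEmb.{v} l m),
      ψ m hm f ≫ face E g = ψ l (g.le.trans hm) (g.comp f)) →
    ∃ φ : a ⟶ E.obj ⟨n + 1⟩, ∀ (m : ℕ) (hm : m ≤ n) (f : OrdEmb.{v} m (n + 1)),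
      φ ≫ face E f = ψ m hm f

variable (E : ChainOp.{v, u} ⥤ C) {a : C}

section

variable [∀ n, Nonempty (a ⟶ E.obj ⟨n⟩)]

/-- The condition that `x` is a cone on `φ`, where the cones `κ` on the faces are given. -/
def IsConeOn {n : ℕ} (κ : ∀ m < n, (a ⟶ E.obj ⟨m⟩) → (a ⟶ E.obj ⟨m + 1⟩)) (φ : a ⟶ E.obj ⟨n⟩)
    (x : a ⟶ E.obj ⟨n + 1⟩) : Prop :=
  (∀ (m : ℕ) (f : OrdEmb.{v} m n), x ≫ face E f.avoid = φ ≫ face E f) ∧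
    ∀ (m : ℕ) (hm : m < n) (f : OrdEmb.{v} m n),
      x ≫ face E f.keep = κ m hm (φ ≫ face E f)

/-- A cone operation on the maps from `a` to the values of `E`. -/
noncomputable def coneMap (n : ℕ) (φ : a ⟶ E.obj ⟨n⟩) : a ⟶ E.obj ⟨n + 1⟩ :=
  Classical.epsilon (IsConeOn E (fun m _ ψ => coneMap m ψ) φ)
termination_by n

variable {E}

lemma isConeOn_coneMap (h : HasFillers E a) (n : ℕ) (φ : a ⟶ E.obj ⟨n⟩) :
    IsConeOn E (fun m _ ψ => coneMap E m ψ) φ (coneMap E n φ) := by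
  induction n using Nat.strong_induction_on with
  | _ n ih =>
    rw [coneMap]
    apply Classical.epsilon_spec
    obtain ⟨x, hx⟩ := h n (fun m _ f => match m, f with
      | _, .avoid f => φ ≫ face E f
      | _, .keep f => coneMap E _ (φ ≫ face E f)) (by
        rintro m hm f l g
        cases f with
        | avoid f =>
          rw [OrdEmb.comp_avoid]
          exact (Category.assoc ..).trans (congr_arg (φ ≫ ·) (face_comp E f g).symm)
        | @keep m _ f =>
          cases g with
          | avoid g =>
            refine ((ih m hm (φ ≫ face E f)).1 _ g).trans ?_
            exact (Category.assoc ..).trans (congr_arg (φ ≫ ·) (face_comp E f g).symm)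
          | @keep l _ g =>
            have e : φ ≫ face E (g.comp f) = (φ ≫ face E f) ≫ face E g :=
              (congr_arg (φ ≫ ·) (face_comp E f g)).trans (Category.assoc ..).symm
            refine Eq.trans ?_ (congr_arg (coneMap E l) e.symm)
            obtain hl | rfl := g.le.lt_or_eq
            · exact (ih m hm (φ ≫ face E f)).2 l hl g
            · obtain rfl := Subsingleton.elim g (OrdEmb.id l)
              have h₂ : face E (OrdEmb.id l).keep = 𝟙 _ := E.map_id _
              simp only [face_id, h₂, Category.comp_id])
    exact ⟨x, fun m f => hx m f.le f.avoid, fun m hm f => hx (m + 1) hm f.keep⟩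

lemma coneMap_avoid (h : HasFillers E a) {n : ℕ} (φ : a ⟶ E.obj ⟨n⟩) {m : ℕ}
    (f : OrdEmb.{v} m n) : coneMap E n φ ≫ face E f.avoid = φ ≫ face E f :=
  (isConeOn_coneMap h n φ).1 m f

lemma coneMap_keep (h : HasFillers E a) {n : ℕ} (φ : a ⟶ E.obj ⟨n⟩) {m : ℕ}
    (f : OrdEmb.{v} m n) :
    coneMap E n φ ≫ face E f.keep = coneMap E m (φ ≫ face E f) := by
  obtain hm | rfl := f.le.lt_or_eq
  · exact (isConeOn_coneMap h n φ).2 m hm f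
  · obtain rfl := Subsingleton.elim f (OrdEmb.id m)
    have h₂ : face E (OrdEmb.id m).keep = 𝟙 _ := E.map_id _
    simp only [face_id, h₂, Category.comp_id]

end

/-- The functor adding a new greatest element. -/
def ChainOp.cone : ChainOp.{v, u} ⥤ ChainOp.{v, u} where
  obj n := ⟨n.len + 1⟩
  map f := OrdEmb.keep f
  map_id _ := rfl
  map_comp _ _ := rfl

/-- The inclusion of a chain in the chain with a new greatest element. -/
def ChainOp.coneToId : ChainOp.cone.{v, u} ⟶ 𝟭 _ where
  app n := OrdEmb.avoid (OrdEmb.id n.len)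
  naturality n m f := by
    change OrdEmb.avoid ((OrdEmb.id _).comp f) = OrdEmb.avoid (OrdEmb.comp f (.id _))
    rw [OrdEmb.id_comp, OrdEmb.comp_id]

variable {E}

/-- The cone operation on the category of arrows from `a` to `E`. -/
noncomputable def coneArrow [∀ n, Nonempty (a ⟶ E.obj ⟨n⟩)] (h : HasFillers E a) :
    StructuredArrow a E ⥤ StructuredArrow a E where
  obj x := StructuredArrow.mk (Y := ChainOp.cone.obj x.right) (coneMap E x.right.len x.hom)
  map {x y} f := StructuredArrow.homMk (ChainOp.cone.map f.right)
    ((coneMap_keep h x.hom f.right).trans (congr_arg (coneMap E y.right.len)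
      (StructuredArrow.w f)))

lemma anodyneExtensions_nerve_structuredArrow [∀ n, Nonempty (a ⟶ E.obj ⟨n⟩)]
    (h : HasFillers E a) :
    SSet.anodyneExtensions
      (nerveFull (fun x : StructuredArrow a E => 0 < x.right.len)).ι :=
  anodyneExtensions_nerveFull_ι _ (coneArrow h) (fun _ => Nat.succ_pos _)
    { app x := StructuredArrow.homMk (ChainOp.coneToId.app x.right) (by
        refine (coneMap_avoid h x.hom (.id _)).trans ?_
        exact (congr_arg (x.hom ≫ ·) (face_id E _)).trans (Category.comp_id _))
      naturality x y f := by
        ext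
        exact ChainOp.coneToId.naturality f.right }

end Fillers

section Frame

variable {C : Type (max u v)} [Category.{v} C]

lemma exists_pullback_family [HasFiniteLimits C] {K Y Z : C} {ι : Type w} [Finite ι]
    (b : ι → (K ⟶ Y)) (p : Z ⟶ Y) :
    ∃ (P : C) (t : P ⟶ K) (z : ι → (P ⟶ Z)), (∀ i, z i ≫ p = t ≫ b i) ∧
      (∀ {a : C} (x₀ : a ⟶ K) (y : ι → (a ⟶ Z)), (∀ i, y i ≫ p = x₀ ≫ b i) →
        ∃ x : a ⟶ P, x ≫ t = x₀ ∧ ∀ i, x ≫ z i = y i) ∧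
      ∀ {a : C} (x x' : a ⟶ P), x ≫ t = x' ≫ t → (∀ i, x ≫ z i = x' ≫ z i) → x = x' := by
  refine ⟨pullback (Pi.lift b) (Limits.Pi.map fun _ : ι => p), pullback.fst _ _,
    fun i => pullback.snd _ _ ≫ Pi.π _ i, fun i => ?_, fun x₀ y h => ?_, fun x x' h h' => ?_⟩
  · have := congr_arg (· ≫ Pi.π _ i) (pullback.condition (f := Pi.lift b)
      (g := Limits.Pi.map fun _ : ι => p))
    simpa using this.symm
  · have hy : x₀ ≫ Pi.lift b = Pi.lift y ≫ Limits.Pi.map fun _ : ι => p := by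
      ext i
      simp [h]
    exact ⟨pullback.lift x₀ (Pi.lift y) hy, pullback.lift_fst ..,
      fun i => by rw [pullback.lift_snd_assoc, limit.lift_π]; rfl⟩
  · apply pullback.hom_ext h
    ext i
    simpa using h' i

/-- A functor `G` over `F` which is obtained by replacing `F.obj ⟨n⟩` by an object `Z` over it. -/
structure FrameStep {F G : ChainOp.{v, u} ⥤ C} (t : G ⟶ F) (n : ℕ) {Z : C} (p : Z ⟶ F.obj ⟨n⟩) where
  q : G.obj ⟨n⟩ ⟶ Z
  exists_lift {a : C} {k : ChainOp.{v, u}} (x₀ : a ⟶ F.obj k) (y : (k ⟶ ⟨n⟩) → (a ⟶ Z))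
    (h : ∀ f, y f ≫ p = x₀ ≫ F.map f) :
    ∃ x : a ⟶ G.obj k, x ≫ t.app k = x₀ ∧ ∀ f, x ≫ G.map f ≫ q = y f
  hom_ext {a : C} {k : ChainOp.{v, u}} (x x' : a ⟶ G.obj k) (h : x ≫ t.app k = x' ≫ t.app k)
    (h' : ∀ f, x ≫ G.map f ≫ q = x' ≫ G.map f ≫ q) : x = x'
  fac : q ≫ p = t.app ⟨n⟩

instance (m n : ChainOp.{v, u}) : Finite (m ⟶ n) := inferInstanceAs (Finite (OrdEmb _ _))

instance (n : ChainOp.{v, u}) : Subsingleton (n ⟶ n) :=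
  inferInstanceAs (Subsingleton (OrdEmb _ _))

lemma exists_frameStep [HasFiniteLimits C] (F : ChainOp.{v, u} ⥤ C) (n : ℕ) {Z : C}
    (p : Z ⟶ F.obj ⟨n⟩) :
    ∃ (G : ChainOp.{v, u} ⥤ C) (t : G ⟶ F), Nonempty (FrameStep t n p) := by
  choose P t z hz hl he using fun k : ChainOp.{v, u} =>
    exists_pullback_family (fun f : k ⟶ ⟨n⟩ => F.map f) p
  have hm {k l : ChainOp.{v, u}} (g : k ⟶ l) := hl l (t k ≫ F.map g) (fun f => z k (g ≫ f))
    (fun f => by rw [hz, Category.assoc, F.map_comp])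
  choose m hm₁ hm₂ using @hm
  let G : ChainOp.{v, u} ⥤ C :=
    { obj := P
      map := m
      map_id k := he k _ _ (by simp [hm₁]) (by simp [hm₂])
      map_comp f g := he _ _ _ (by simp [hm₁, reassoc_of% hm₁]) (by simp [hm₂]) }
  have h {k : ChainOp.{v, u}} (f : k ⟶ ⟨n⟩) : G.map f ≫ z _ (𝟙 _) = z k f := by
    simp [G, hm₂]
  exact ⟨G, { app := t, naturality _ _ _ := hm₁ _ }, ⟨{
    q := z _ (𝟙 _)
    exists_lift {a k} x₀ y h' := by
      simp only [h]
      exact hl k x₀ y h'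
    hom_ext {a k} x x' h₁ h₂ := by
      simp only [h] at h₂
      exact he k x x' h₁ h₂
    fac := by simp [hz] }⟩⟩

namespace FrameStep

variable {F G : ChainOp.{v, u} ⥤ C} {t : G ⟶ F} {n : ℕ} {Z : C} {p : Z ⟶ F.obj ⟨n⟩}
  (s : FrameStep t n p)

instance : IsIso s.q := by
  have h (f : (⟨n⟩ : ChainOp.{v, u}) ⟶ ⟨n⟩) : f = 𝟙 _ := Subsingleton.elim _ _
  obtain ⟨x, hx, hx'⟩ := s.exists_lift p (fun _ => 𝟙 Z) (fun f => by simp [h f])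
  have hq : x ≫ s.q = 𝟙 Z := by simpa using hx' (𝟙 _)
  refine ⟨x, s.hom_ext _ _ (by simp [hx, s.fac]) fun f => ?_, hq⟩
  simp [h f, hq]

lemma rlp_app (s : FrameStep t n p) {W : MorphismProperty C} (hp : W.rlp p) (k : ChainOp.{v, u}) :
    W.rlp (t.app k) := by
  intro A B i hi
  refine ⟨fun {f g} sq => ?_⟩
  have := hp i hi
  have sq' (e : k ⟶ ⟨n⟩) : CommSq (f ≫ G.map e ≫ s.q) i p (g ≫ F.map e) := ⟨by
    simp only [Category.assoc, s.fac, NatTrans.naturality, reassoc_of% sq.w]⟩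
  obtain ⟨x, hx, hx'⟩ := s.exists_lift g (fun e => (sq' e).lift) (fun e => (sq' e).fac_right)
  refine ⟨⟨⟨x, s.hom_ext _ _ ?_ fun e => ?_, hx⟩⟩⟩
  · rw [Category.assoc, hx, sq.w]
  · rw [Category.assoc, hx', (sq' e).fac_left]

end FrameStep

variable (C) in
/-- A tower of functors on `ChainOp`. -/
structure Tower where
  F : ℕ → ChainOp.{v, u} ⥤ C
  τ {m n : ℕ} (h : m ≤ n) : F n ⟶ F m
  τ_refl (n : ℕ) : τ (le_refl n) = 𝟙 _
  τ_trans {l m n : ℕ} (h : m ≤ n) (h' : l ≤ m) : τ h ≫ τ h' = τ (h'.trans h)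

namespace Tower

variable (T : Tower.{v, u} C)

/-- The values of the diagonal of a tower on morphisms. -/
def diagMap {m n : ℕ} (f : OrdEmb.{v} m n) : (T.F n).obj ⟨n⟩ ⟶ (T.F m).obj ⟨m⟩ :=
  (T.F n).map (X := ⟨n⟩) (Y := ⟨m⟩) f ≫ (T.τ f.le).app ⟨m⟩

/-- The component of a map to `(T.F n).obj ⟨k⟩` at `f`. -/
def comp {a : C} {k m n : ℕ} (x : a ⟶ (T.F n).obj ⟨k⟩) (hm : m ≤ n) (f : OrdEmb.{v} m k) :
    a ⟶ (T.F m).obj ⟨m⟩ :=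
  x ≫ (T.F n).map (X := ⟨k⟩) (Y := ⟨m⟩) f ≫ (T.τ hm).app ⟨m⟩

variable {T}

lemma τ_τ_app {l m n : ℕ} (h : m ≤ n) (h' : l ≤ m) (k : ChainOp.{v, u}) :
    (T.τ h).app k ≫ (T.τ h').app k = (T.τ (h'.trans h)).app k := by
  rw [← NatTrans.comp_app, τ_trans]

lemma comp_τ {a : C} {k l m n : ℕ} (x : a ⟶ (T.F n).obj ⟨k⟩) (hm : m ≤ n) (hl : l ≤ m)
    (f : OrdEmb.{v} l k) :
    T.comp (x ≫ (T.τ hm).app ⟨k⟩) hl f = T.comp x (hl.trans hm) f := by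
  simp only [comp, Category.assoc, ← τ_τ_app hm hl, NatTrans.naturality_assoc]

lemma comp_diagMap {a : C} {k l m n : ℕ} (x : a ⟶ (T.F n).obj ⟨k⟩) (hm : m ≤ n)
    (f : OrdEmb.{v} m k) (g : OrdEmb.{v} l m) :
    T.comp x hm f ≫ T.diagMap g = T.comp x (g.le.trans hm) (g.comp f) := by
  have : (T.F n).map (X := ⟨k⟩) (Y := ⟨l⟩) (g.comp f) =
    (T.F n).map (X := ⟨k⟩) (Y := ⟨m⟩) f ≫ (T.F n).map (X := ⟨m⟩) (Y := ⟨l⟩) g :=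
      (T.F n).map_comp (X := ⟨k⟩) (Y := ⟨m⟩) (Z := ⟨l⟩) f g
  simp only [comp, diagMap, Category.assoc, this, ← τ_τ_app hm g.le, NatTrans.naturality_assoc]

lemma comp_refl {a : C} {k n : ℕ} (x : a ⟶ (T.F n).obj ⟨k⟩) (f : OrdEmb.{v} n k) :
    T.comp x le_rfl f = x ≫ (T.F n).map (X := ⟨k⟩) (Y := ⟨n⟩) f := by
  simp [comp, τ_refl]

lemma comp_self {a : C} {m n : ℕ} (x : a ⟶ (T.F n).obj ⟨n⟩) (f : OrdEmb.{v} m n) :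
    T.comp x f.le f = x ≫ T.diagMap f := rfl

lemma comp_map {a : C} {k l m n : ℕ} (x : a ⟶ (T.F n).obj ⟨k⟩) (f : OrdEmb.{v} l k)
    (hm : m ≤ n) (g : OrdEmb.{v} m l) :
    T.comp (x ≫ (T.F n).map (X := ⟨k⟩) (Y := ⟨l⟩) f) hm g = T.comp x hm (g.comp f) := by
  have : (T.F n).map (X := ⟨k⟩) (Y := ⟨m⟩) (g.comp f) =
    (T.F n).map (X := ⟨k⟩) (Y := ⟨l⟩) f ≫ (T.F n).map (X := ⟨l⟩) (Y := ⟨m⟩) g :=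
      (T.F n).map_comp (X := ⟨k⟩) (Y := ⟨l⟩) (Z := ⟨m⟩) f g
  simp only [comp, Category.assoc, this]

variable (T) in
/-- The diagonal of a tower. -/
def diag : ChainOp.{v, u} ⥤ C where
  obj n := (T.F n.len).obj n
  map f := T.diagMap f
  map_id n := by
    have : (T.F n.len).map (X := ⟨n.len⟩) (Y := ⟨n.len⟩) (OrdEmb.id.{v} n.len) = 𝟙 _ :=
      (T.F n.len).map_id _
    change (T.F n.len).map (X := ⟨n.len⟩) (Y := ⟨n.len⟩) (OrdEmb.id.{v} n.len) ≫
      (T.τ (OrdEmb.id.{v} n.len).le).app ⟨n.len⟩ = 𝟙 _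
    rw [this, τ_refl]
    simp
  map_comp {n m l} f g := by
    have := comp_diagMap (𝟙 ((T.F n.len).obj ⟨n.len⟩)) (OrdEmb.le f) f g
    rw [comp_self, comp_self, Category.id_comp, Category.id_comp] at this
    exact this.symm

variable {Z : ℕ → C} {p : ∀ n, Z n ⟶ (T.F n).obj ⟨n + 1⟩}

lemma hom_ext (s : ∀ n, FrameStep (T.τ (Nat.le_add_right n 1)) (n + 1) (p n))
    (h₀ : ∀ k, IsTerminal ((T.F 0).obj k)) {a : C} (n : ℕ) {k : ℕ} (x y : a ⟶ (T.F n).obj ⟨k⟩)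
    (h : ∀ (m : ℕ) (hm : m ≤ n) (f : OrdEmb.{v} m k), T.comp x hm f = T.comp y hm f) :
    x = y := by
  induction n generalizing k with
  | zero => exact (h₀ ⟨k⟩).hom_ext x y
  | succ n ih =>
    refine (s n).hom_ext _ _ (ih _ _ fun m hm f => ?_) fun f => ?_
    · rw [comp_τ, comp_τ, h]
    · have := h (n + 1) le_rfl f
      rw [comp_refl, comp_refl] at this
      simpa using congr_arg (· ≫ (s n).q) this

lemma exists_lift (s : ∀ n, FrameStep (T.τ (Nat.le_add_right n 1)) (n + 1) (p n))
    (h₀ : ∀ k, IsTerminal ((T.F 0).obj k)) {a : C} (n : ℕ) {k : ℕ}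
    (ψ : ∀ m : ℕ, m ≤ n → OrdEmb.{v} m k → (a ⟶ (T.F m).obj ⟨m⟩))
    (hψ : ∀ (m : ℕ) (hm : m ≤ n) (f : OrdEmb.{v} m k) (l : ℕ) (g : OrdEmb.{v} l m),
      ψ m hm f ≫ T.diagMap g = ψ l (g.le.trans hm) (g.comp f)) :
    ∃ x : a ⟶ (T.F n).obj ⟨k⟩, ∀ (m : ℕ) (hm : m ≤ n) (f : OrdEmb.{v} m k),
      T.comp x hm f = ψ m hm f := by
  induction n generalizing k with
  | zero =>
    refine ⟨(h₀ _).from a, fun m hm f => ?_⟩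
    obtain rfl : m = 0 := by simpa using hm
    exact (h₀ _).hom_ext _ _
  | succ n ih =>
    obtain ⟨x₀, hx₀⟩ := ih (fun m hm f => ψ m (hm.trans n.le_succ) f)
      fun m hm f l g => hψ m _ f l g
    have h (f : OrdEmb.{v} (n + 1) k) : (ψ (n + 1) le_rfl f ≫ (s n).q) ≫ p n =
        x₀ ≫ (T.F n).map (X := ⟨k⟩) (Y := ⟨n + 1⟩) f := by
      rw [Category.assoc, (s n).fac]
      refine hom_ext s h₀ n _ _ fun m hm g => ?_
      rw [comp_τ, comp_map, hx₀, ← hψ (n + 1) le_rfl f m g]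
      rfl
    obtain ⟨x, hx, hx'⟩ := (s n).exists_lift x₀ (fun f => ψ (n + 1) le_rfl f ≫ (s n).q) h
    refine ⟨x, fun m hm f => ?_⟩
    obtain hm' | rfl := hm.lt_or_eq
    · rw [← hx₀ m (Nat.le_of_lt_succ hm') f, ← hx, comp_τ]
    · rw [comp_refl, ← cancel_mono (s n).q, ← hx' f, Category.assoc]

lemma hasFillers (s : ∀ n, FrameStep (T.τ (Nat.le_add_right n 1)) (n + 1) (p n))
    (h₀ : ∀ k, IsTerminal ((T.F 0).obj k)) {a : C}
    (ha : ∀ (n : ℕ) (x : a ⟶ (T.F n).obj ⟨n + 1⟩), ∃ y, y ≫ p n = x) : HasFillers T.diag a := by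
  intro n ψ hψ
  obtain ⟨x₀, hx₀⟩ := exists_lift s h₀ n ψ hψ
  obtain ⟨y, hy⟩ := ha n x₀
  obtain ⟨x, hx, -⟩ := (s n).exists_lift x₀ (fun _ => y) fun f => by
    rw [Subsingleton.elim f (𝟙 _), hy, CategoryTheory.Functor.map_id, Category.comp_id]
  refine ⟨x, fun m hm f => ?_⟩
  rw [← hx₀ m hm f, ← hx, comp_τ]
  rfl

end Tower

/-- If every morphism factors as one in `W` followed by one with the right lifting property with
respect to `W`, then there is a Reedy fibrant functor on `ChainOp` whose values are terminal in
degree zero and `W`-objects in positive degrees. -/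
lemma exists_frame [HasFiniteLimits C] {B : C} (hB : IsInitial B) (W : MorphismProperty C)
    [W.RespectsIso]
    (hW : ∀ {X Y : C} (f : X ⟶ Y), ∃ (Z : C) (i : X ⟶ Z) (p : Z ⟶ Y), W i ∧ W.rlp p ∧ i ≫ p = f) :
    ∃ E : ChainOp.{v, u} ⥤ C, Nonempty (IsTerminal (E.obj ⟨0⟩)) ∧
      (∀ n, W (hB.to (E.obj ⟨n + 1⟩))) ∧ (∀ n, W.rlp (terminal.from (E.obj ⟨n⟩))) ∧
      ∀ a, W (hB.to a) → HasFillers E a := by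
  choose Z i p hi hp hip using @hW
  choose G t s using fun (F : ChainOp.{v, u} ⥤ C) (n : ℕ) =>
    exists_frameStep F n (p (hB.to (F.obj ⟨n⟩)))
  let F (n : ℕ) : ChainOp.{v, u} ⥤ C :=
    Nat.rec ((Functor.const _).obj (⊤_ C)) (fun n F => G F (n + 1)) n
  let R : ℕᵒᵖ ⥤ ChainOp.{v, u} ⥤ C := Functor.ofOpSequence (X := F) fun n => t (F n) (n + 1)
  let T : Tower.{v, u} C :=
    { F := F
      τ h := R.map (homOfLE h).op
      τ_refl _ := R.map_id _
      τ_trans h h' := (R.map_comp (homOfLE h).op (homOfLE h').op).symm }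
  have hT (n : ℕ) : T.τ (Nat.le_add_right n 1) = t (F n) (n + 1) :=
    Functor.ofOpSequence_map_homOfLE_succ _ n
  have s' (n : ℕ) : FrameStep (T.τ (Nat.le_add_right n 1)) (n + 1)
      (p (hB.to ((T.F n).obj ⟨n + 1⟩))) := by
    rw [hT]
    exact (s (F n) (n + 1)).some
  have h₀ (k : ChainOp.{v, u}) : IsTerminal ((T.F 0).obj k) := terminalIsTerminal
  have hF (n : ℕ) (k : ChainOp.{v, u}) : W.rlp (terminal.from ((T.F n).obj k)) := by
    induction n with
    | zero =>
      have : IsIso (terminal.from ((T.F 0).obj k)) :=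
        isIso_of_isTerminal (h₀ k) terminalIsTerminal _
      exact fun _ _ _ _ => inferInstance
    | succ n ih =>
      rw [← terminal.comp_from ((T.τ (Nat.le_add_right n 1)).app k)]
      exact MorphismProperty.comp_mem _ _ _ ((s' n).rlp_app (hp _) k) ih
  refine ⟨T.diag, ⟨h₀ ⟨0⟩⟩, fun n => ?_, fun n => hF n ⟨n⟩, fun a ha => ?_⟩
  · refine (W.arrow_mk_iso_iff (Arrow.isoMk (Iso.refl B) (asIso (s' n).q) (hB.hom_ext _ _))).2
      (?_ : W (hB.to (Z (hB.to ((T.F n).obj ⟨n + 1⟩)))))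
    rw [hB.hom_ext (hB.to _) (i _)]
    exact hi _
  · refine Tower.hasFillers s' h₀ fun n x => ?_
    have := hp (hB.to ((T.F n).obj ⟨n + 1⟩)) _ ha
    have sq : CommSq (hB.to _) (hB.to a) (p (hB.to ((T.F n).obj ⟨n + 1⟩))) x :=
      ⟨hB.hom_ext _ _⟩
    exact ⟨sq.lift, sq.fac_right⟩

end Frame

section UnderAcyclicCofibrations

namespace ModelStructure

variable {D : Type u} [Category.{v} D] (M : ModelStructure D)

lemma isRetractOf_id {X Y : D} (e : X ⟶ Y) [IsIso e] : IsRetractOf e (𝟙 Y) :=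
  ⟨e, inv e, 𝟙 Y, 𝟙 Y, by simp, by simp, by simp, by simp⟩

lemma W_of_isIso {X Y : D} (e : X ⟶ Y) [IsIso e] : M.W e :=
  M.W_retract (isRetractOf_id e) (M.W_id Y)

lemma Cof_of_isIso {X Y : D} (e : X ⟶ Y) [IsIso e] : M.Cof e :=
  M.Cof_retract (isRetractOf_id e) (M.Cof_id Y)

lemma Fib_of_isIso {X Y : D} (e : X ⟶ Y) [IsIso e] : M.Fib e :=
  M.Fib_retract (isRetractOf_id e) (M.Fib_id Y)

/-- The morphisms under `d` which are acyclic cofibrations. -/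
def underAcof (d : D) : MorphismProperty (Under d) := fun _ _ f => M.Cof f.right ∧ M.W f.right

instance (d : D) : (M.underAcof d).RespectsIso := by
  have h {X Y : Under d} (e : X ≅ Y) : IsIso e.hom.right :=
    inferInstanceAs (IsIso ((Under.forget d).mapIso e).hom)
  refine MorphismProperty.RespectsIso.mk _ (fun e f hf => ?_) (fun e f hf => ?_)
  all_goals have := h e
  · exact ⟨M.Cof_comp _ _ (M.Cof_of_isIso e.hom.right) hf.1,
      M.W_comp _ _ (M.W_of_isIso e.hom.right) hf.2⟩
  · exact ⟨M.Cof_comp _ _ hf.1 (M.Cof_of_isIso e.hom.right),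
      M.W_comp _ _ hf.2 (M.W_of_isIso e.hom.right)⟩

lemma rlp_underAcof {d : D} {X Y : Under d} {p : X ⟶ Y} (hp : M.Fib p.right) :
    (M.underAcof d).rlp p := by
  intro A B i hi
  refine ⟨fun {f g} sq => ?_⟩
  have := M.lifting_acof_fib i.right p.right hi.1 hi.2 hp
  have sq' : CommSq f.right i.right p.right g.right := ⟨congr_arg (·.right) sq.w⟩
  exact ⟨⟨⟨Under.homMk sq'.lift (by
    rw [← Under.w i, Category.assoc, sq'.fac_left, Under.w]), by
      ext; exact sq'.fac_left, by ext; exact sq'.fac_right⟩⟩⟩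

lemma exists_factorization_underAcof {d : D} {X Y : Under d} (f : X ⟶ Y) :
    ∃ (Z : Under d) (i : X ⟶ Z) (p : Z ⟶ Y), M.underAcof d i ∧ M.Fib p.right ∧ i ≫ p = f := by
  obtain ⟨Z, i, p, h₁, h₂, h₃, h₄⟩ := M.fact_acof_fib f.right
  exact ⟨Under.mk (X.hom ≫ i), Under.homMk i, Under.homMk p (by simp [h₄]), ⟨h₁, h₂⟩, h₃,
    by ext; exact h₄⟩

lemma Fib_of_rlp_underAcof {d : D} {X Y : Under d} {p : X ⟶ Y} (hp : (M.underAcof d).rlp p) :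
    M.Fib p.right := by
  obtain ⟨Z, i, q, hi, hq, rfl⟩ := M.exists_factorization_underAcof p
  have := hp i hi
  have sq : CommSq (𝟙 X) i (i ≫ q) q := ⟨by simp⟩
  refine M.Fib_retract ⟨i.right, sq.lift.right, 𝟙 _, 𝟙 _, ?_, by simp, by simp, ?_⟩ hq
  · exact congr_arg (·.right) sq.fac_left
  · rw [Category.comp_id]
    exact congr_arg (·.right) sq.fac_right

end ModelStructure

variable {D : Type u} [Category.{v} D] [HasFiniteLimits D] (M : ModelStructure D) (d : D)

lemma exists_fibRepl_frame :
    ∃ E : ChainOp.{v, u} ⥤ Under d, Nonempty (IsTerminal (E.obj ⟨0⟩)) ∧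
      (∀ n, M.W (E.obj ⟨n + 1⟩).hom ∧ M.Cof (E.obj ⟨n + 1⟩).hom ∧
        Fibrant M (E.obj ⟨n + 1⟩).right) ∧
      ∀ a : FibRepl M d, HasFillers E (Under.mk a.j) ∧
        ∀ n, Nonempty (Under.mk a.j ⟶ E.obj ⟨n⟩) := by
  have hB : IsInitial (Under.mk (𝟙 d)) := Under.mkIdInitial
  have hto {X : Under d} : (hB.to X).right = X.hom := by
    simpa using Under.w (hB.to X)
  have hT : IsTerminal (⊤_ Under d).right :=
    IsTerminal.isTerminalObj (Under.forget d) _ terminalIsTerminal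
  have : HasFiniteLimits (Under d) := ⟨fun _ _ _ => inferInstance⟩
  obtain ⟨E, h₀, h₁, h₂, h₃⟩ := exists_frame.{v, u} hB (M.underAcof d) fun f => by
    obtain ⟨Z, i, p, hi, hp, h⟩ := M.exists_factorization_underAcof f
    exact ⟨Z, i, p, hi, M.rlp_underAcof hp, h⟩
  refine ⟨E, h₀, fun n => ⟨?_, ?_, ?_⟩, fun a => ?_⟩
  · exact hto ▸ (h₁ n).2
  · exact hto ▸ (h₁ n).1
  · have h := M.Fib_of_rlp_underAcof (h₂ (n + 1))
    rw [Fibrant, terminal.hom_ext (terminal.from _)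
      ((terminal.from (E.obj ⟨n + 1⟩)).right ≫ terminal.from (⊤_ Under d).right)]
    have := isIso_of_isTerminal hT terminalIsTerminal (terminal.from _)
    exact M.Fib_comp _ _ h (M.Fib_of_isIso _)
  · have ha : M.underAcof d (hB.to (Under.mk a.j)) := by
      constructor
      · rw [hto]; exact a.hC
      · rw [hto]; exact a.hW
    refine ⟨h₃ _ ha, fun n => ?_⟩
    have := h₂ n _ ha
    have sq : CommSq (hB.to (E.obj ⟨n⟩)) (hB.to (Under.mk a.j)) (terminal.from _)
      (terminal.from _) := ⟨terminal.hom_ext _ _⟩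
    exact ⟨sq.lift⟩

end UnderAcyclicCofibrations

section Bar

open MonoidalCategory Opposite

variable {A Q C : Type u} [Category.{v} A] [Category.{v} Q] [Category.{v} C]

/-- The chain of arrows from `c` to `E` determined by its first arrow and a chain in `Q`. -/
def chainOfFirst {E : Q ⥤ C} {c : C} {m : ℕ} (y : ComposableArrows Q m) (ψ : c ⟶ E.obj (y.obj 0)) :
    ComposableArrows (StructuredArrow c E) m where
  obj i := StructuredArrow.mk (ψ ≫ E.map (y.map (homOfLE (Fin.zero_le i))))
  map f := StructuredArrow.homMk (y.map f) (by
    simp only [StructuredArrow.mk_hom_eq_self, Category.assoc, ← E.map_comp, ← y.map_comp]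
    rfl)

lemma structuredArrow_hom_heq {E : Q ⥤ C} {c : C} {X X' Y Y' : StructuredArrow c E} (hX : X = X')
    (hY : Y = Y') (f : X ⟶ Y) (f' : X' ⟶ Y') (h : f.right ≍ f'.right) : f ≍ f' := by
  subst hX hY
  exact heq_of_eq (StructuredArrow.ext _ _ (eq_of_heq h))

lemma chainOfFirst_eta {E : Q ⥤ C} {c : C} {m : ℕ} (x : ComposableArrows (StructuredArrow c E) m) :
    chainOfFirst (x ⋙ StructuredArrow.proj c E : ComposableArrows Q m) (x.obj 0).hom = x := by
  have h (i : Fin (m + 1)) : (x.obj 0).hom ≫ E.map (x.map (homOfLE (Fin.zero_le i))).right =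
    (x.obj i).hom := StructuredArrow.w _
  have h' (i : Fin (m + 1)) : (chainOfFirst (x ⋙ StructuredArrow.proj c E : ComposableArrows Q m)
      (x.obj 0).hom).obj i = x.obj i :=
    (congr_arg (StructuredArrow.mk (T := E) (Y := (x.obj i).right)) (h i)).trans
      (StructuredArrow.eq_mk (x.obj i)).symm
  exact CategoryTheory.Functor.hext h' fun i j f =>
    structuredArrow_hom_heq (h' i) (h' j) _ _ HEq.rfl

lemma chainOfFirst_congr {E : Q ⥤ C} {c c' : C} {m : ℕ} {y y' : ComposableArrows Q m}
    {ψ : c ⟶ E.obj (y.obj 0)} {ψ' : c ⟶ E.obj (y'.obj 0)} (e : c' ⟶ c) [IsIso e] (hy : y = y')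
    (h : e ≫ ψ ≍ e ≫ ψ') : chainOfFirst y ψ = chainOfFirst y' ψ' := by
  subst hy
  rw [(cancel_epi e).1 (eq_of_heq h)]

variable (R : A ⥤ C) (E : Q ⥤ C)

lemma map_comp_comp_map_comp {a₀ a₁ a₂ : A} {y₀ y₁ y₂ : Q} (f : a₀ ⟶ a₁) (g : a₁ ⟶ a₂)
    (φ : R.obj a₂ ⟶ E.obj y₀) (h : y₀ ⟶ y₁) (k : y₁ ⟶ y₂) :
    R.map (f ≫ g) ≫ φ ≫ E.map (h ≫ k) =
      R.map f ≫ (R.map g ≫ φ ≫ E.map h) ≫ E.map k := by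
  simp

lemma map_comp_comp_of_eq {a₀ a₁ a₂ : A} {y₀ y₁ : Q} (f : a₀ ⟶ a₁) (g : a₁ ⟶ a₂)
    (φ : R.obj a₂ ⟶ E.obj y₀) (h : y₀ ⟶ y₁) {ψ : R.obj a₂ ⟶ E.obj y₁} (hψ : φ ≫ E.map h = ψ) :
    R.map (f ≫ g) ≫ ψ = R.map f ≫ (R.map g ≫ φ) ≫ E.map h := by
  simp [← hψ]

/-- The simplices of the two-sided bar construction of `R` and `E`. -/
structure BarSimplex (m : ℕ) where
  a : ComposableArrows A m
  y : ComposableArrows Q m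
  φ : R.obj (a.obj (Fin.last m)) ⟶ E.obj (y.obj 0)

/-- The two-sided bar construction of `R` and `E`. -/
def bar : SSet.{max u v} where
  obj m := BarSimplex R E m.unop.len
  map {m m'} θ := ↾fun z =>
    { a := (nerve A).map θ z.a
      y := (nerve Q).map θ z.y
      φ := R.map (z.a.map (homOfLE (Fin.le_last _))) ≫ z.φ ≫
        E.map (z.y.map (homOfLE (Fin.zero_le _))) }
  map_id m := by
    ext z
    obtain ⟨a, y, φ⟩ := z
    change BarSimplex.mk a y (R.map (a.map (𝟙 _)) ≫ φ ≫ E.map (y.map (𝟙 _))) = _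
    simp
  map_comp {m m' m''} θ θ' := by
    ext z
    obtain ⟨a, y, φ⟩ := z
    refine congr_arg (BarSimplex.mk _ _) ?_
    refine Eq.trans ?_ (map_comp_comp_map_comp R E (a.map _) (a.map _) φ (y.map _) (y.map _))
    exact congr_arg₂ (fun f g => R.map f ≫ φ ≫ E.map g) (a.map_comp _ _) (y.map_comp _ _)

namespace bar

/-- The first projection of the bar construction. -/
def fst : bar R E ⟶ nerve A where
  app _ := ↾BarSimplex.a
  naturality _ _ _ := rfl

/-- The second projection of the bar construction. -/
def snd : bar R E ⟶ nerve Q where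
  app _ := ↾BarSimplex.y
  naturality _ _ _ := rfl

/-- The part of the bar construction lying over the chains of objects satisfying `P`. -/
def full (P : Q → Prop) : (bar R E).Subcomplex := (nerveFull P).preimage (snd R E)

variable {R E}

/-- The part of the bar construction over a simplex `s` of `nerve A`. -/
def chart {n : ℕ} (s : ComposableArrows A n) :
    nerve (StructuredArrow (R.obj (s.obj (Fin.last n))) E) ⊗ Δ[n] ⟶ bar R E where
  app m := ↾fun z =>
    { a := (SSet.yonedaEquiv.symm s : Δ[n] ⟶ nerve A).app m z.2
      y := (z.1 ⋙ StructuredArrow.proj _ _ : ComposableArrows Q m.unop.len)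
      φ := R.map (s.map (homOfLE (Fin.le_last _))) ≫
        ((z.1 : ComposableArrows _ m.unop.len).obj 0).hom }
  naturality m m' θ := by
    ext ⟨x, β⟩
    refine congr_arg (BarSimplex.mk _ _) ?_
    have h := StructuredArrow.w ((x : ComposableArrows _ m.unop.len).map (homOfLE (Fin.zero_le
      (θ.unop.toOrderHom 0))))
    refine Eq.trans ?_ (map_comp_comp_of_eq R E (s.map _) (s.map _) _ _ h)
    exact congr_arg (fun f => R.map f ≫ _) (s.map_comp _ _)

lemma asOrderHom_last_of_notMem_boundary {n : ℕ} {m : SimplexCategoryᵒᵖ}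
    {θ : (Δ[n] : SSet.{w}).obj m} (hθ : θ ∉ (∂Δ[n] : (Δ[n] : SSet.{w}).Subcomplex).obj m) :
    SSet.stdSimplex.asOrderHom θ (Fin.last _) = Fin.last n := by
  obtain ⟨i, hi⟩ := not_not.1 hθ (Fin.last n)
  exact le_antisymm (Fin.le_last _) (hi ▸ (SSet.stdSimplex.asOrderHom θ).monotone (Fin.le_last i))

lemma isIso_map_of_eq {n : ℕ} (s : ComposableArrows A n) {i j : Fin (n + 1)} (h : i = j)
    (f : i ⟶ j) : IsIso (s.map f) := by
  subst h
  rw [Subsingleton.elim f (𝟙 i)]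
  infer_instance

/-- The charts of the bar construction cover it. -/
def localCover (P : Q → Prop) {n : ℕ} (s : ComposableArrows A n)
    (h : SSet.anodyneExtensions (nerveFull fun x : StructuredArrow (R.obj (s.obj (Fin.last n))) E =>
      P x.right).ι) :
    LocalCover (fst R E) (full R E P) (SSet.yonedaEquiv.symm s : Δ[n] ⟶ nerve A) where
  Φ := nerve (StructuredArrow (R.obj (s.obj (Fin.last n))) E)
  sub := nerveFull fun x => P x.right
  anodyne := h
  Ψ := chart s
  app_Ψ _ := rfl
  bijective {m} θ hθ z hz := by
    obtain ⟨a, y, φ⟩ := z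
    change a = (SSet.yonedaEquiv.symm s : Δ[n] ⟶ nerve A).app m θ at hz
    subst hz
    let e : R.obj (((SSet.yonedaEquiv.symm s : Δ[n] ⟶ nerve A).app m θ :
        ComposableArrows A m.unop.len).obj (Fin.last _)) ⟶ R.obj (s.obj (Fin.last n)) :=
      R.map (s.map (homOfLE (Fin.le_last (SSet.stdSimplex.asOrderHom θ (Fin.last _)))))
    have he : IsIso e :=
      @CategoryTheory.Functor.map_isIso _ _ _ _ _ _ R _
        (isIso_map_of_eq s (asOrderHom_last_of_notMem_boundary hθ) _)
    refine ⟨chainOfFirst y (inv e ≫ φ), ?_, fun x hx => ?_⟩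
    · refine congr_arg (BarSimplex.mk _ _) ?_
      change e ≫ (inv e ≫ φ) ≫ E.map (y.map (𝟙 _)) = φ
      simp
    · obtain ⟨h₁, h₂⟩ := ((BarSimplex.mk.injEq ..).mp hx).2
      rw [← chainOfFirst_eta x]
      refine chainOfFirst_congr e h₁ (h₂.trans ?_)
      simp
  mem z hz := hz
  of_mem z _ hz := hz

lemma anodyneExtensions_full_ι (P : Q → Prop)
    (h : ∀ a : A, SSet.anodyneExtensions
      (nerveFull fun x : StructuredArrow (R.obj a) E => P x.right).ι) :
    SSet.anodyneExtensions (full R E P).ι :=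
  anodyneExtensions_of_localCover (ρ := fst R E) fun n σ => by
    obtain ⟨s, rfl⟩ := SSet.yonedaEquiv.symm.surjective σ
    exact ⟨localCover P s (h _)⟩

variable (R) in
/-- The section of the first projection of the bar construction given by a terminal value. -/
def ofIsTerminal {q : Q} (hq : IsTerminal (E.obj q)) : nerve A ⟶ bar R E where
  app _ := ↾fun a => { a := a, y := (Functor.const _).obj q, φ := hq.from _ }
  naturality _ _ _ := by
    ext a
    exact congr_arg (BarSimplex.mk _ _) (hq.hom_ext _ _)

lemma ofIsTerminal_fst {q : Q} (hq : IsTerminal (E.obj q)) :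
    ofIsTerminal R hq ≫ fst R E = 𝟙 _ := rfl

end bar
end Bar

section Contraction

/-- The vertex of the nerve given by an object. -/
def nervePoint {C : Type u} [Category.{v} C] (c : C) : (⊤_ SSet.{max u v}) ⟶ nerve C where
  app _ := ↾fun _ => (Functor.const _).obj c
  naturality _ _ _ := rfl

lemma nervePoint_nerveMap {C D : Type u} [Category.{v} C] [Category.{v} D] (F : C ⥤ D) (c : C) :
    nervePoint c ≫ nerveMap F = nervePoint (F.obj c) := by
  ext n x
  exact CategoryTheory.Functor.hext (fun _ => rfl) fun _ _ _ => heq_of_eq (F.map_id c)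

/-- The chains of positive length. -/
abbrev posLen : ObjectProperty ChainOp.{v, u} := fun n => 0 < n.len

/-- The cone functor on the chains of positive length. -/
def coneOnPos : posLen.{v, u}.FullSubcategory ⥤ posLen.{v, u}.FullSubcategory :=
  posLen.lift (posLen.ι ⋙ ChainOp.cone) fun _ => Nat.succ_pos _

/-- The chain of length one. -/
def chainOne : posLen.{v, u}.FullSubcategory := ⟨⟨1⟩, Nat.one_pos⟩

/-- The inclusion of the cone points. -/
def coneOnPosToConst : coneOnPos.{v, u} ⟶ (Functor.const _).obj chainOne where
  app n := ⟨OrdEmb.keep (OrdEmb.empty n.obj.len)⟩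
  naturality n m f := by
    ext
    change OrdEmb.comp (OrdEmb.keep (OrdEmb.empty m.obj.len)) (OrdEmb.keep f.hom) =
      OrdEmb.comp (OrdEmb.id 1) (OrdEmb.keep (OrdEmb.empty n.obj.len))
    rw [OrdEmb.keep_comp_keep, OrdEmb.id_comp, Subsingleton.elim (OrdEmb.comp _ _)]

/-- The inclusion of a chain of positive length in its cone. -/
def coneOnPosToId : coneOnPos.{v, u} ⟶ 𝟭 _ where
  app n := ⟨ChainOp.coneToId.app n.obj⟩
  naturality n m f := by
    ext
    exact ChainOp.coneToId.naturality f.hom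

lemma htpy_nerve_posLen :
    Htpy (𝟙 (nerve posLen.{v, u}.FullSubcategory)) (terminal.from _ ≫ nervePoint chainOne) :=
  .trans _ _ _ (.symm _ _ (.rel _ _ (.of_natTrans coneOnPosToId)))
    (.rel _ _ (.of_natTrans coneOnPosToConst))

namespace bar

variable {A Q C : Type (max u v)} [Category.{v} A] [Category.{v} Q] [Category.{v} C]
  {R : A ⥤ C} {E : Q ⥤ C} (P : ObjectProperty Q)

/-- The projection of `bar.full R E P` to the nerve of the full subcategory given by `P`. -/
def sndFull : (full R E P : SSet) ⟶ nerve P.FullSubcategory where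
  app m := ↾fun z => P.lift (z.1.y : Fin _ ⥤ Q) z.2
  naturality _ _ _ := by ext _; rfl

variable {P} {E' : P.FullSubcategory ⥤ A} (hR : R.FullyFaithful) (e : P.ι ⋙ E ⟶ E' ⋙ R)

lemma arrow_hom_heq {X X' Y Y' : Arrow A} (hX : X = X') (hY : Y = Y') (f : X ⟶ Y) (f' : X' ⟶ Y')
    (h : f.left ≍ f'.left) (h' : f.right ≍ f'.right) : f ≍ f' := by
  subst hX hY
  exact heq_of_eq (Arrow.hom_ext _ _ (eq_of_heq h) (eq_of_heq h'))

lemma comp_preimage {a₀ a₁ a₂ : A} {y₀ : Q} {y₁ y₂ : P.FullSubcategory} (f : a₀ ⟶ a₁)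
    (g : a₁ ⟶ a₂) (φ : R.obj a₂ ⟶ E.obj y₀) (h : y₀ ⟶ y₁.obj) (k : y₁ ⟶ y₂) :
    f ≫ hR.preimage (R.map g ≫ φ ≫ E.map (h ≫ k.hom) ≫ e.app y₂) =
      hR.preimage (R.map (f ≫ g) ≫ φ ≫ E.map h ≫ e.app y₁) ≫ E'.map k := by
  apply hR.map_injective
  have hk : E.map k.hom ≫ e.app y₂ = e.app y₁ ≫ R.map (E'.map k) := e.naturality k
  simp [hk]

variable (R E) in
lemma map_comp_comp_map_comp_comp {a₀ a₁ a₂ : A} {y₀ y₁ y₂ : Q} (f : a₀ ⟶ a₁) (g : a₁ ⟶ a₂)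
    (φ : R.obj a₂ ⟶ E.obj y₀) (h : y₀ ⟶ y₁) (k : y₁ ⟶ y₂) {c : C} (ε : E.obj y₂ ⟶ c) :
    R.map (f ≫ g) ≫ φ ≫ E.map (h ≫ k) ≫ ε =
      R.map f ≫ (R.map g ≫ φ ≫ E.map h) ≫ E.map k ≫ ε := by
  simp

/-- When `E` factors through `R` on the objects satisfying `P`, the simplices of the bar
construction over `P` give chains of arrows. -/
def fullToArrow : (full R E P : SSet.{max u v}) ⟶ nerve (Arrow A) where
  app m := ↾fun z =>
    { obj i := Arrow.mk (hR.preimage (R.map (z.1.a.map (homOfLE (Fin.le_last i))) ≫ z.1.φ ≫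
        E.map (z.1.y.map (homOfLE (Fin.zero_le i))) ≫ e.app ⟨z.1.y.obj i, z.2 i⟩))
      map {i j} f := Arrow.homMk (z.1.a.map f) (E'.map ⟨z.1.y.map f⟩)
        ((congr_arg (fun k => z.1.a.map f ≫ hR.preimage (_ ≫ z.1.φ ≫ E.map k ≫ _))
          (z.1.y.map_comp (homOfLE (Fin.zero_le i)) f)).trans <|
          (comp_preimage hR e (y₁ := ⟨z.1.y.obj i, z.2 i⟩) (y₂ := ⟨z.1.y.obj j, z.2 j⟩) _ _ _ _
            ⟨z.1.y.map f⟩).trans <|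
          congr_arg (fun k => hR.preimage (R.map k ≫ _) ≫ _) (z.1.a.map_comp f _).symm)
      map_id i := Arrow.hom_ext _ _ (z.1.a.map_id i)
        ((congr_arg (fun k => E'.map ⟨k⟩) (z.1.y.map_id i)).trans (E'.map_id _))
      map_comp f g := Arrow.hom_ext _ _ (z.1.a.map_comp f g)
        ((congr_arg (fun k => E'.map ⟨k⟩) (z.1.y.map_comp f g)).trans (E'.map_comp _ _)) :
      ComposableArrows (Arrow A) m.unop.len }
  naturality m m' θ := by
    ext ⟨⟨a, y, φ⟩, hz⟩
    have h (i : Fin (m'.unop.len + 1)) := congr_arg₂ (fun f g => Arrow.mk (hR.preimage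
      (R.map f ≫ φ ≫ E.map g ≫ e.app ⟨y.obj (θ.unop.toOrderHom i), hz _⟩)))
      (a.map_comp (homOfLE (θ.unop.toOrderHom.monotone (Fin.le_last i))) (homOfLE (Fin.le_last _)))
      (y.map_comp (homOfLE (Fin.zero_le _)) (homOfLE (θ.unop.toOrderHom.monotone (Fin.zero_le i))))
    have h' (i : Fin (m'.unop.len + 1)) := (congr_arg (fun k => Arrow.mk (hR.preimage k))
      (map_comp_comp_map_comp_comp R E _ _ φ _ _ _)).symm.trans (h i).symm
    exact CategoryTheory.Functor.hext h' fun i j f =>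
      arrow_hom_heq (h' i) (h' j) _ _ HEq.rfl HEq.rfl

lemma fullToArrow_leftFunc :
    fullToArrow hR e ≫ nerveMap Arrow.leftFunc = (full R E P).ι ≫ fst R E := rfl

lemma fullToArrow_rightFunc :
    fullToArrow hR e ≫ nerveMap Arrow.rightFunc = sndFull P ≫ nerveMap E' := rfl

end bar
end Contraction

section Conclusion

lemma weaklyContractible_of_htpy {X : SSet.{w}} (x : (⊤_ SSet.{w}) ⟶ X)
    (h : ∀ (K : SSet.{w}), KanComplex K → ∀ g : X ⟶ K, Htpy g (terminal.from _ ≫ x ≫ g)) :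
    WeaklyContractible X := by
  refine fun K hK => ⟨fun g => ⟨x ≫ g, .symm _ _ (h K hK g)⟩, fun f f' hf => ?_⟩
  have hx : x ≫ terminal.from X = 𝟙 _ := terminal.hom_ext _ _
  simpa [reassoc_of% hx] using hf.precomp x

lemma htpy_full_ι_fst {A Q C : Type (max u v)} [Category.{v} A] [Category.{v} Q] [Category.{v} C]
    {R : A ⥤ C} (hR : R.FullyFaithful) {E : Q ⥤ C} {P : ObjectProperty Q}
    {E' : P.FullSubcategory ⥤ A} (e : P.ι ⋙ E ⟶ E' ⋙ R) {q : P.FullSubcategory}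
    (hP : Htpy (𝟙 (nerve P.FullSubcategory)) (terminal.from _ ≫ nervePoint q)) :
    Htpy ((bar.full R E P).ι ≫ bar.fst R E)
      ((bar.full R E P).ι ≫ terminal.from _ ≫ nervePoint (E'.obj q)) := by
  rw [← bar.fullToArrow_leftFunc hR e]
  refine .trans _ _ _ (.rel _ _ ((SHomotopy.of_natTrans Arrow.leftToRight).precomp _)) ?_
  rw [bar.fullToArrow_rightFunc]
  have h := (hP.postcomp (nerveMap E')).precomp (bar.sndFull (R := R) (E := E) P)
  rw [Category.id_comp, Category.assoc, nervePoint_nerveMap, ← Category.assoc (bar.sndFull P)] at h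
  rwa [← Category.assoc (bar.full R E P).ι, Subsingleton.elim ((bar.full R E P).ι ≫ _)]

lemma weaklyContractible_nerve {A C : Type (max u v)} [Category.{v} A] [Category.{v} C]
    {R : A ⥤ C} (hR : R.FullyFaithful) {E : ChainOp.{v, u} ⥤ C} (hE : IsTerminal (E.obj ⟨0⟩))
    (h : ∀ a, HasFillers E (R.obj a)) (h' : ∀ a n, Nonempty (R.obj a ⟶ E.obj ⟨n⟩))
    {E' : posLen.{v, u}.FullSubcategory ⥤ A} (e : posLen.ι ⋙ E ⟶ E' ⋙ R) :
    WeaklyContractible (nerve A) := by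
  refine weaklyContractible_of_htpy (nervePoint (E'.obj chainOne)) fun K _ g => ?_
  have hg := htpy_of_anodyne (bar.full R E posLen)
    (bar.anodyneExtensions_full_ι _ fun a => anodyneExtensions_nerve_structuredArrow (h a))
    (bar.fst R E ≫ g) ((terminal.from _ ≫ nervePoint (E'.obj chainOne)) ≫ g)
    ((htpy_full_ι_fst hR e htpy_nerve_posLen).postcomp g)
  have hg' := hg.precomp (bar.ofIsTerminal R hE)
  rw [← Category.assoc, bar.ofIsTerminal_fst, Category.id_comp] at hg'
  simpa [← Category.assoc, Subsingleton.elim (bar.ofIsTerminal R hE ≫ terminal.from _)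
    (terminal.from (nerve A))] using hg'

lemma ModelStructure.W_of_comp_eq {D : Type u} [Category.{v} D] (M : ModelStructure D) {X Y Z : D}
    {f : X ⟶ Y} {g : Y ⟶ Z} {h : X ⟶ Z} (hf : M.W f) (hh : M.W h) (e : f ≫ g = h) : M.W g :=
  M.W_of_precomp f g hf (e ▸ hh)

variable {D : Type u} [Category.{v} D] [HasTerminal D] {M : ModelStructure D} {d : D}

/-- The inclusion of the fibrant replacements of `d` in the objects under `d`. -/
def FibRepl.toUnder : FibRepl M d ⥤ Under d where
  obj a := Under.mk a.j
  map f := Under.homMk f.1 f.2.2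

/-- Maps under `d` of fibrant replacements are weak equivalences. -/
def FibRepl.toUnderFullyFaithful : (FibRepl.toUnder (M := M) (d := d)).FullyFaithful where
  preimage {a b} f := ⟨f.right, M.W_of_comp_eq a.hW b.hW (Under.w f), Under.w f⟩

end Conclusion

/-- for a model category `D` and an object `d`, the category of acyclic
cofibrations `d → d'` with fibrant target (with morphisms the weak equivalences under
`d`) has weakly contractible nerve. -/
theorem statement11 {D : Type u} [Category.{v} D]
    [HasFiniteLimits D] [HasFiniteColimits D] (M : ModelStructure D) (d : D) :
    WeaklyContractible (nerve (FibRepl M d)) := by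
  obtain ⟨E, ⟨hE⟩, hpos, h⟩ := exists_fibRepl_frame M d
  have hpos' (x : posLen.{v, u}.FullSubcategory) : M.W (E.obj x.obj).hom ∧
      M.Cof (E.obj x.obj).hom ∧ Fibrant M (E.obj x.obj).right := by
    obtain ⟨⟨_ | n⟩, hn⟩ := x
    · exact (lt_irrefl _ hn).elim
    · exact hpos n
  exact weaklyContractible_nerve FibRepl.toUnderFullyFaithful hE (fun a => (h a).1)
    (fun a => (h a).2) (E' :=
      { obj x := ⟨(E.obj x.obj).right, (E.obj x.obj).hom, (hpos' x).1, (hpos' x).2.1, (hpos' x).2.2⟩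
        map f := FibRepl.toUnderFullyFaithful.preimage (E.map f.hom)
        map_id x := FibRepl.toUnderFullyFaithful.map_injective (E.map_id _)
        map_comp f g := FibRepl.toUnderFullyFaithful.map_injective (E.map_comp _ _) })
    { app x := 𝟙 (E.obj x.obj)
      naturality _ _ f :=
        (Category.comp_id (E.map f.hom)).trans (Category.id_comp (E.map f.hom)).symm }

end Paper
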